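/- Let u : Ω → ℝ be a complete connected translating graph in the direction of a unit vector v (over an orthonormal basis (a,b,v) of ℝ³), with Ω ⊆ ℝ² its open connected domain of definition. Then Ω is unbounded and simply connected. -/

import Mathlib

open MeasureTheory Metric Real EuclideanSpace
open scoped RealInnerProductSpace ENNReal NNReal

noncomputable section

abbrev E3 : Type := EuclideanSpace ℝ (Fin 3)

def e1 : E3 := EuclideanSpace.single 0 1
def e2 : E3 := EuclideanSpace.single 1 1
def e3 : E3 := EuclideanSpace.single 2 1

/-- First partial derivative of `u` in the first variable. -/
def pds (u : ℝ × ℝ → ℝ) (p : ℝ × ℝ) : ℝ := fderiv ℝ u p (1, 0)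

/-- First partial derivative of `u` in the second variable. -/
def pdt (u : ℝ × ℝ → ℝ) (p : ℝ × ℝ) : ℝ := fderiv ℝ u p (0, 1)

/-- `S` is a translating graph in the direction of the unit vector `v`, with respect to the
orthonormal basis `(a, b, v)` of `ℝ³`, over the open connected domain `Ω ⊆ ℝ²`, given by the
smooth function `u : Ω → ℝ` solving the translator equation. -/
structure IsTranslatingGraph (a b v : E3) (Ω : Set (ℝ × ℝ)) (u : ℝ × ℝ → ℝ)
    (S : Set E3) : Prop where
  norm_a : ‖a‖ = 1
  norm_b : ‖b‖ = 1
  norm_v : ‖v‖ = 1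
  inner_ab : ⟪a, b⟫ = 0
  inner_av : ⟪a, v⟫ = 0
  inner_bv : ⟪b, v⟫ = 0
  isOpen_dom : IsOpen Ω
  isConnected_dom : IsConnected Ω
  smooth : ContDiffOn ℝ (⊤ : ℕ∞) u Ω
  pde : ∀ p ∈ Ω,
    (1 + (pdt u p) ^ 2) * pds (fun q => pds u q) p
      - 2 * pds u p * pdt u p * pdt (fun q => pds u q) p
      + (1 + (pds u p) ^ 2) * pdt (fun q => pdt u q) p
    = (1 + (pds u p) ^ 2 + (pdt u p) ^ 2) *
        (⟪e3, v⟫ - pds u p * ⟪e3, a⟫ - pdt u p * ⟪e3, b⟫)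
  graph_eq : S = {q : E3 | ∃ p ∈ Ω, q = p.1 • a + p.2 • b + u p • v}

/-- Entropy of a surface. -/
def entropy (S : Set E3) : ℝ≥0∞ :=
  ⨆ (x₀ : E3) (s₀ : ℝ) (_ : 0 < s₀),
    (ENNReal.ofReal (4 * π * s₀))⁻¹ *
      ∫⁻ q in S, ENNReal.ofReal (Real.exp (-‖q - x₀‖ ^ 2 / (4 * s₀))) ∂(μH[2])

/-- Number of connected components (as a cardinal). -/
def numComponents (A : Set E3) : Cardinal := Cardinal.mk (ConnectedComponents A)

def vθ (θ : ℝ) : E3 := Real.sin θ • e3 + Real.cos θ • e2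
def bθ (θ : ℝ) : E3 := Real.cos θ • e3 - Real.sin θ • e2


/-- The point of the translating graph over parameter `p`, for the basis `(e₁, b_θ, v_θ)`. -/
def graphPtθ (θ : ℝ) (u : ℝ × ℝ → ℝ) (p : ℝ × ℝ) : E3 :=
  p.1 • e1 + p.2 • bθ θ + u p • vθ θ

/-- The Gauss map of a translating graph in the direction `v_θ`, as a function of the
parameter `p ∈ Ω`: `N = (v_θ − u_s e₁ − u_t b_θ)/√(1+u_s²+u_t²)`. -/
def gaussMapθ (θ : ℝ) (u : ℝ × ℝ → ℝ) (p : ℝ × ℝ) : E3 :=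
  (Real.sqrt (1 + (pds u p) ^ 2 + (pdt u p) ^ 2))⁻¹ •
    (vθ θ - pds u p • e1 - pdt u p • bθ θ)

open Filter Topology Set

lemma IsLocalMax.hasDerivAt_second_nonpos {f f' : ℝ → ℝ} {s : ℝ}
    (hf : ∀ᶠ τ in 𝓝 0, HasDerivAt f (f' τ) τ) (hf' : HasDerivAt f' s 0)
    (hmax : IsLocalMax f 0) : f' 0 = 0 ∧ s ≤ 0 := by
  have h0 : f' 0 = 0 := hmax.hasDerivAt_eq_zero hf.self_of_nhds
  refine ⟨h0, ?_⟩
  by_contra! hs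
  have hd : deriv f =ᶠ[𝓝 0] f' := hf.mono fun τ h => h.deriv
  have hdd : deriv (deriv f) 0 = s := by rw [hd.deriv_eq, hf'.deriv]
  have hmin : IsLocalMin f 0 := isLocalMin_of_deriv_deriv_pos (by rw [hdd]; exact hs)
    (by rw [hd.self_of_nhds, h0]) hf.self_of_nhds.continuousAt
  have hconst : f =ᶠ[𝓝 0] fun _ => f 0 := by
    filter_upwards [hmin, hmax] with τ h1 h2 using le_antisymm h2 h1
  have hd0 : deriv f =ᶠ[𝓝 0] fun _ => 0 := by
    filter_upwards [hconst.eventuallyEq_nhds] with τ h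
    rw [h.deriv_eq]; simp
  have : deriv (deriv f) 0 = 0 := by rw [hd0.deriv_eq]; simp
  linarith

section Directional

variable {Ω : Set (ℝ × ℝ)} {u : ℝ × ℝ → ℝ}

lemma contDiffAt_of_mem (hΩ : IsOpen Ω) (hu : ContDiffOn ℝ (⊤ : ℕ∞) u Ω) {p : ℝ × ℝ}
    (hp : p ∈ Ω) : ContDiffAt ℝ 2 u p :=
  (hu.contDiffAt (hΩ.mem_nhds hp)).of_le (WithTop.coe_le_coe.2 le_top)

lemma differentiableAt_fderiv_of_mem (hΩ : IsOpen Ω) (hu : ContDiffOn ℝ (⊤ : ℕ∞) u Ω)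
    {p : ℝ × ℝ} (hp : p ∈ Ω) : DifferentiableAt ℝ (fderiv ℝ u) p :=
  ((contDiffAt_of_mem hΩ hu hp).fderiv_right (m := 1) (by norm_num)).differentiableAt
    one_ne_zero

lemma clm_apply_prod {F : Type*} [NormedAddCommGroup F] [NormedSpace ℝ F]
    (L : ℝ × ℝ →L[ℝ] F) (d : ℝ × ℝ) : L d = d.1 • L (1, 0) + d.2 • L (0, 1) := by
  rw [← map_smul, ← map_smul, ← map_add]
  congr 1
  ext <;> simp

lemma hasDerivAt_line (hΩ : IsOpen Ω) (hu : ContDiffOn ℝ (⊤ : ℕ∞) u Ω) (p d : ℝ × ℝ) (τ : ℝ)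
    (hp : p + τ • d ∈ Ω) :
    HasDerivAt (fun τ : ℝ => u (p + τ • d))
      (d.1 * pds u (p + τ • d) + d.2 * pdt u (p + τ • d)) τ := by
  have h1 : HasDerivAt (fun τ : ℝ => p + τ • d) d τ := by
    simpa using ((hasDerivAt_id τ).smul_const d).const_add p
  have h2 : HasFDerivAt u (fderiv ℝ u (p + τ • d)) (p + τ • d) :=
    ((contDiffAt_of_mem hΩ hu hp).differentiableAt (by simp)).hasFDerivAt
  have h3 := h2.comp_hasDerivAt τ h1
  rw [clm_apply_prod _ d] at h3
  exact h3

lemma hasDerivAt_line_second (hΩ : IsOpen Ω) (hu : ContDiffOn ℝ (⊤ : ℕ∞) u Ω) {p : ℝ × ℝ}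
    (d : ℝ × ℝ) (hp : p ∈ Ω) :
    HasDerivAt (fun τ : ℝ => d.1 * pds u (p + τ • d) + d.2 * pdt u (p + τ • d))
      (d.1 ^ 2 * pds (fun q => pds u q) p + 2 * d.1 * d.2 * pdt (fun q => pds u q) p
        + d.2 ^ 2 * pdt (fun q => pdt u q) p) 0 := by
  have h1 : HasDerivAt (fun τ : ℝ => p + τ • d) d 0 := by
    simpa using ((hasDerivAt_id (0 : ℝ)).smul_const d).const_add p
  have hF := (differentiableAt_fderiv_of_mem hΩ hu hp).hasFDerivAt
  have hF0 : HasFDerivAt (fderiv ℝ u) (fderiv ℝ (fderiv ℝ u) p) (p + (0 : ℝ) • d) := by simpa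
  have hs : ∀ w : ℝ × ℝ, HasFDerivAt (fun q => fderiv ℝ u q w)
      ((fderiv ℝ (fderiv ℝ u) p).flip w) (p + (0 : ℝ) • d) := fun w => by
    simpa using hF0.clm_apply (hasFDerivAt_const w (p + (0 : ℝ) • d))
  have e : ∀ w z : ℝ × ℝ, fderiv ℝ (fun q => fderiv ℝ u q w) p z = fderiv ℝ (fderiv ℝ u) p z w :=
    fun w z => by
      have := (hs w).fderiv
      rw [zero_smul, add_zero] at this
      rw [this]; rfl
  have hsymm : fderiv ℝ (fderiv ℝ u) p (1, 0) (0, 1) = fderiv ℝ (fderiv ℝ u) p (0, 1) (1, 0) :=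
    (contDiffAt_of_mem hΩ hu hp).isSymmSndFDerivAt (by simp) _ _
  have h3 := ((hs (1, 0)).comp_hasDerivAt (0 : ℝ) h1).const_mul d.1
  have h4 := ((hs (0, 1)).comp_hasDerivAt (0 : ℝ) h1).const_mul d.2
  refine (h3.add h4).congr_deriv ?_
  simp only [pds, pdt, e, ContinuousLinearMap.flip_apply]
  rw [clm_apply_prod _ d]
  simp [hsymm]
  ring

end Directional

/-- A solution `u` of the translator equation over the planar domain `Ω`, with translation
direction `(α, β, c)` in the frame of the graph, which is proper as a function on `Ω`. -/
structure IsProperTranslator (α β c : ℝ) (Ω : Set (ℝ × ℝ)) (u : ℝ × ℝ → ℝ) : Prop where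
  isOpen : IsOpen Ω
  abs_c_le : |c| ≤ 1
  smooth : ContDiffOn ℝ (⊤ : ℕ∞) u Ω
  pde : ∀ p ∈ Ω,
    (1 + (pdt u p) ^ 2) * pds (fun q => pds u q) p
      - 2 * pds u p * pdt u p * pdt (fun q => pds u q) p
      + (1 + (pds u p) ^ 2) * pdt (fun q => pdt u q) p
    = (1 + (pds u p) ^ 2 + (pdt u p) ^ 2) * (c - pds u p * α - pdt u p * β)
  proper : ∀ M : ℝ, IsClosed {p | p ∈ Ω ∧ |u p| ≤ M}

/-- The squared Euclidean distance in the plane. -/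
def sqDist (q x : ℝ × ℝ) : ℝ := (x.1 - q.1) ^ 2 + (x.2 - q.2) ^ 2

lemma continuous_sqDist (q : ℝ × ℝ) : Continuous (sqDist q) := by
  unfold sqDist; fun_prop

lemma sqDist_nonneg (q x : ℝ × ℝ) : 0 ≤ sqDist q x := by
  unfold sqDist; positivity

lemma pds_neg (u : ℝ × ℝ → ℝ) : pds (fun q => -u q) = fun q => -pds u q := by
  ext p; simp [pds, fderiv_fun_neg]

lemma pdt_neg (u : ℝ × ℝ → ℝ) : pdt (fun q => -u q) = fun q => -pdt u q := by
  ext p; simp [pdt, fderiv_fun_neg]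

namespace IsProperTranslator

variable {α β c : ℝ} {Ω : Set (ℝ × ℝ)} {u : ℝ × ℝ → ℝ}

lemma neg (h : IsProperTranslator α β c Ω u) :
    IsProperTranslator α β (-c) Ω (fun q => -u q) where
  isOpen := h.isOpen
  abs_c_le := by simpa using h.abs_c_le
  smooth := h.smooth.neg
  pde p hp := by
    have := h.pde p hp
    simp only [pds_neg, pdt_neg] at this ⊢
    linarith
  proper M := by simpa using h.proper M

/-- If a radial function touches `u` from above, it satisfies the translator inequality. -/
lemma radial_touching (h : IsProperTranslator α β c Ω u) {x q : ℝ × ℝ} (hx : x ∈ Ω)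
    {F F' : ℝ → ℝ} {F2 : ℝ}
    (hF : ∀ᶠ r in 𝓝 (sqDist q x), HasDerivAt F (F' r) r)
    (hF' : HasDerivAt F' F2 (sqDist q x))
    (hmax : IsLocalMax (fun z => u z - F (sqDist q z)) x) :
    (1 + 4 * F' (sqDist q x) ^ 2 * sqDist q x) *
        (c - 2 * F' (sqDist q x) * ((x.1 - q.1) * α + (x.2 - q.2) * β))
      ≤ 4 * F2 * sqDist q x + 4 * F' (sqDist q x) + 8 * F' (sqDist q x) ^ 3 * sqDist q x := by
  have key : ∀ d : ℝ × ℝ,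
      d.1 * pds u x + d.2 * pdt u x
        = F' (sqDist q x) * (2 * ((x.1 - q.1) * d.1 + (x.2 - q.2) * d.2)) ∧
      d.1 ^ 2 * pds (fun q => pds u q) x + 2 * d.1 * d.2 * pdt (fun q => pds u q) x
        + d.2 ^ 2 * pdt (fun q => pdt u q) x
        ≤ F2 * (2 * ((x.1 - q.1) * d.1 + (x.2 - q.2) * d.2)) ^ 2
          + F' (sqDist q x) * (2 * (d.1 ^ 2 + d.2 ^ 2)) := by
    intro d
    have hc : Continuous fun τ : ℝ => x + τ • d := by fun_prop
    have hc0 : Tendsto (fun τ : ℝ => x + τ • d) (𝓝 0) (𝓝 x) := by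
      simpa using hc.tendsto 0
    have hn : ∀ τ : ℝ, HasDerivAt (fun τ : ℝ => sqDist q (x + τ • d))
        (2 * ((x.1 + τ * d.1 - q.1) * d.1 + (x.2 + τ * d.2 - q.2) * d.2)) τ := by
      intro τ
      have e1 : HasDerivAt (fun τ : ℝ => x.1 + τ * d.1 - q.1) d.1 τ := by
        simpa using (((hasDerivAt_id τ).mul_const d.1).const_add x.1).sub_const q.1
      have e2 : HasDerivAt (fun τ : ℝ => x.2 + τ * d.2 - q.2) d.2 τ := by
        simpa using (((hasDerivAt_id τ).mul_const d.2).const_add x.2).sub_const q.2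
      refine ((e1.pow 2).add (e2.pow 2)).congr_deriv ?_
      norm_num
      ring
    have hn' : HasDerivAt (fun τ : ℝ =>
        2 * ((x.1 + τ * d.1 - q.1) * d.1 + (x.2 + τ * d.2 - q.2) * d.2))
        (2 * (d.1 ^ 2 + d.2 ^ 2)) 0 := by
      have e1 : HasDerivAt (fun τ : ℝ => x.1 + τ * d.1 - q.1) d.1 0 := by
        simpa using (((hasDerivAt_id (0 : ℝ)).mul_const d.1).const_add x.1).sub_const q.1
      have e2 : HasDerivAt (fun τ : ℝ => x.2 + τ * d.2 - q.2) d.2 0 := by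
        simpa using (((hasDerivAt_id (0 : ℝ)).mul_const d.2).const_add x.2).sub_const q.2
      refine (((e1.mul_const d.1).add (e2.mul_const d.2)).const_mul 2).congr_deriv ?_
      ring
    have hx0 : x + (0 : ℝ) • d = x := by simp
    have hsq : Tendsto (fun τ : ℝ => sqDist q (x + τ • d)) (𝓝 0) (𝓝 (sqDist q x)) :=
      ((continuous_sqDist q).tendsto x).comp hc0
    have d1 : ∀ᶠ τ : ℝ in 𝓝 0, HasDerivAt (fun τ : ℝ => u (x + τ • d) - F (sqDist q (x + τ • d)))
        (d.1 * pds u (x + τ • d) + d.2 * pdt u (x + τ • d)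
          - F' (sqDist q (x + τ • d)) *
            (2 * ((x.1 + τ * d.1 - q.1) * d.1 + (x.2 + τ * d.2 - q.2) * d.2))) τ := by
      filter_upwards [hc0 (h.isOpen.mem_nhds hx), hsq.eventually hF] with τ h1 h2
      exact (hasDerivAt_line h.isOpen h.smooth x d τ h1).sub (h2.comp τ (hn τ))
    have hF'0 : HasDerivAt F' F2 (sqDist q (x + (0 : ℝ) • d)) := by rwa [hx0]
    have d2 := (hasDerivAt_line_second h.isOpen h.smooth d hx).sub
      ((hF'0.comp (0 : ℝ) (hn 0)).mul hn')
    have hm : IsLocalMax (fun τ : ℝ => u (x + τ • d) - F (sqDist q (x + τ • d))) 0 := by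
      have := hc0.eventually hmax
      filter_upwards [this] with τ hτ
      simpa using hτ
    obtain ⟨r1, r2⟩ := IsLocalMax.hasDerivAt_second_nonpos d1 d2 hm
    simp only [hx0, zero_mul, add_zero, Function.comp_apply] at r1 r2
    refine ⟨by linarith, by linarith⟩
  obtain ⟨gs, hss⟩ := key (1, 0)
  obtain ⟨gt, htt⟩ := key (0, 1)
  obtain ⟨-, hst⟩ := key (pdt u x, -pds u x)
  have hp := h.pde x hx
  have hN : sqDist q x = (x.1 - q.1) ^ 2 + (x.2 - q.2) ^ 2 := rfl
  simp only [one_mul, zero_mul, add_zero, zero_add, mul_one, mul_zero] at gs gt hss htt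
  set p := F' (sqDist q x)
  rw [gs, gt] at hp hst
  set y1 := x.1 - q.1
  set y2 := x.2 - q.2
  rw [hN]
  ring_nf at hp hst hss htt ⊢
  linarith

/-- `u + A √(|x - q|² - ρ)` has no interior local maximum when `A` is large. -/
lemma not_isLocalMax_add_sqrt (h : IsProperTranslator α β c Ω u) {x q : ℝ × ℝ} (hx : x ∈ Ω)
    (hq : 0 ≤ (x.1 - q.1) * α + (x.2 - q.2) * β) {ρ D : ℝ} (hρ : 0 < ρ) (hρx : ρ < sqDist q x)
    (hD : 0 < D) (hxD : sqDist q x ≤ D ^ 2) :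
    ¬ IsLocalMax (fun z => u z + (D + 2) * √(sqDist q z - ρ)) x := by
  intro hmax
  set A := D + 2 with hA
  set N := sqDist q x with hN
  set s := √(N - ρ) with hs
  have hs0 : 0 < s := Real.sqrt_pos.2 (by linarith)
  have hss : s ^ 2 = N - ρ := Real.sq_sqrt (by linarith)
  have hsq : ∀ r, ρ < r → HasDerivAt (fun r => √(r - ρ)) (1 / (2 * √(r - ρ))) r := fun r hr =>
    ((hasDerivAt_id r).sub_const ρ).sqrt (by simp; linarith)
  have hF : ∀ᶠ r in 𝓝 N, HasDerivAt (fun r => -(A * √(r - ρ)))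
      ((fun r => -(A * (1 / (2 * √(r - ρ))))) r) r := by
    filter_upwards [lt_mem_nhds hρx] with r hr
    exact ((hsq r hr).const_mul A).neg
  have hF' : HasDerivAt (fun r => -(A * (1 / (2 * √(r - ρ))))) (A / (4 * s ^ 3)) N := by
    have e := (((hsq N hρx).const_mul 2).inv (by positivity)).const_mul A |>.neg
    have e2 : (fun r => -(A * (1 / (2 * √(r - ρ))))) = -fun y => A * (2 * √(y - ρ))⁻¹ := by
      ext r; simp
    rw [e2]
    refine e.congr_deriv ?_
    rw [← hs]
    field_simp
    ring
  have ht := h.radial_touching (q := q) hx hF hF' (by simpa using hmax)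
  rw [← hN] at ht
  simp only [← hs] at ht
  set Y := (x.1 - q.1) * α + (x.2 - q.2) * β
  have hc := (abs_le.1 h.abs_c_le).1
  have hN0 : 0 < N := hρ.trans hρx
  have h1 : -(1 + 4 * (-(A * (1 / (2 * s)))) ^ 2 * N) ≤
      (1 + 4 * (-(A * (1 / (2 * s)))) ^ 2 * N) * (c - 2 * (-(A * (1 / (2 * s)))) * Y) := by
    have : -1 ≤ c - 2 * (-(A * (1 / (2 * s)))) * Y := by
      have : 0 ≤ 2 * (A * (1 / (2 * s))) * Y := by positivity
      linarith
    have h2 : 0 ≤ 1 + 4 * (-(A * (1 / (2 * s)))) ^ 2 * N := by positivity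
    nlinarith
  have h2 := h1.trans ht
  have h3 : -(s ^ 3 + A ^ 2 * N * s) ≤ A * N - 2 * A * s ^ 2 - A ^ 3 * N := by
    have e1 : -(1 + 4 * (-(A * (1 / (2 * s)))) ^ 2 * N) * s ^ 3 = -(s ^ 3 + A ^ 2 * N * s) := by
      field_simp
      ring
    have e2 : (4 * (A / (4 * s ^ 3)) * N + 4 * -(A * (1 / (2 * s)))
        + 8 * (-(A * (1 / (2 * s)))) ^ 3 * N) * s ^ 3
        = A * N - 2 * A * s ^ 2 - A ^ 3 * N := by
      field_simp
      ring
    rw [← e1, ← e2]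
    exact mul_le_mul_of_nonneg_right h2 (by positivity)
  have hsD : s ≤ D := by
    apply Real.sqrt_le_iff.2 ⟨hD.le, by linarith⟩
  have h4 : s ^ 3 ≤ N * D := by
    calc s ^ 3 = s ^ 2 * s := by ring
      _ ≤ N * D := by gcongr; linarith
  have h5 : A ^ 2 * N * s ≤ A ^ 2 * N * D := by gcongr
  have h6 : 0 ≤ 2 * A * s ^ 2 := by positivity
  have h7 : N * (A ^ 3 - A - A ^ 2 * D) ≤ N * D := by nlinarith
  have h8 : A ^ 3 - A - A ^ 2 * D ≤ D := le_of_mul_le_mul_left h7 hN0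
  rw [hA] at h8
  nlinarith

/-- A maximum of `u + A √(|x - q|² - ρ)` over the outside of the circle cannot lie on it. -/
lemma not_isMax_on_circle (h : IsProperTranslator α β c Ω u) {x q : ℝ × ℝ} (hx : x ∈ Ω)
    {ρ A : ℝ} (hρ : 0 < ρ) (hρx : sqDist q x = ρ) (hA : 0 < A) :
    ¬ ∀ᶠ z in 𝓝 x, ρ ≤ sqDist q z → u z + A * √(sqDist q z - ρ) ≤ u x := by
  intro hmax
  set d := x - q with hd
  have hc0 : Tendsto (fun τ : ℝ => x + τ • d) (𝓝 0) (𝓝 x) := by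
    simpa using (by fun_prop : Continuous fun τ : ℝ => x + τ • d).tendsto 0
  have hN : ∀ τ : ℝ, sqDist q (x + τ • d) = ρ * (1 + τ) ^ 2 := by
    intro τ
    rw [← hρx]
    simp only [sqDist, hd, Prod.fst_add, Prod.snd_add, Prod.smul_fst, Prod.smul_snd,
      Prod.fst_sub, Prod.snd_sub, smul_eq_mul]
    ring
  have hder := hasDerivAt_line h.isOpen h.smooth x d 0 (by simpa using hx)
  obtain ⟨C, hC0, hC⟩ := hder.isBigO_sub.exists_pos
  rw [Asymptotics.isBigOWith_iff] at hC
  have hev : ∀ᶠ τ : ℝ in 𝓝[>] 0, A ^ 2 * (2 * ρ) ≤ C ^ 2 * τ := by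
    filter_upwards [nhdsWithin_le_nhds hC, nhdsWithin_le_nhds (hc0.eventually hmax),
      self_mem_nhdsWithin] with τ h1 h2 h3
    have h3 : 0 < τ := h3
    have hρτ : 0 < ρ * τ := by positivity
    have hρτ2 : 0 < ρ * τ ^ 2 := by positivity
    have h4 := h2 (by rw [hN]; nlinarith)
    simp only [zero_smul, add_zero, sub_zero, Real.norm_eq_abs, abs_of_pos h3] at h1
    have h5 := (abs_le.1 h1).1
    have h6 : A * √(sqDist q (x + τ • d) - ρ) ≤ C * τ := by linarith
    have h7 : (A * √(sqDist q (x + τ • d) - ρ)) ^ 2 ≤ (C * τ) ^ 2 := by gcongr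
    rw [mul_pow, Real.sq_sqrt (by rw [hN]; nlinarith), hN] at h7
    have h8 : A ^ 2 * (2 * ρ) * τ ≤ C ^ 2 * τ * τ := by
      have : 0 ≤ A ^ 2 * ρ * τ ^ 2 := by positivity
      nlinarith
    exact le_of_mul_le_mul_right h8 h3
  have hlim : Tendsto (fun τ : ℝ => C ^ 2 * τ) (𝓝[>] 0) (𝓝 0) := by
    have : Tendsto (fun τ : ℝ => C ^ 2 * τ) (𝓝 0) (𝓝 (C ^ 2 * 0)) :=
      (continuous_const.mul continuous_id).tendsto 0
    simpa using this.mono_left nhdsWithin_le_nhds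
  have := ge_of_tendsto hlim hev
  have : 0 < A ^ 2 * (2 * ρ) := by positivity
  linarith

/-- A one-sided bound for `u` outside a disc, in terms of the boundary values away from the
disc only. -/
lemma le_of_frontier_le (h : IsProperTranslator α β c Ω u) {U : Set (ℝ × ℝ)} (hU : IsOpen U)
    (hUb : Bornology.IsBounded U) {q : ℝ × ℝ}
    (hq : ∀ x ∈ U, 0 ≤ (x.1 - q.1) * α + (x.2 - q.2) * β) {ρ D M : ℝ} (hρ : 0 < ρ)
    (hD : 0 < D) (hUD : ∀ x ∈ closure U, sqDist q x ≤ D ^ 2)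
    (hG : ∀ x ∈ closure U, ρ ≤ sqDist q x → x ∈ Ω)
    (hM : ∀ x ∈ frontier U, ρ ≤ sqDist q x → u x ≤ M) :
    ∀ x ∈ closure U, ρ ≤ sqDist q x → u x ≤ M + (D + 2) * D := by
  intro z hz hzρ
  set G := closure U ∩ {x | ρ ≤ sqDist q x} with hGdef
  have hGc : IsCompact G := hUb.isCompact_closure.inter_right
    (isClosed_le continuous_const (continuous_sqDist q))
  set g := fun z => u z + (D + 2) * √(sqDist q z - ρ) with hg
  have hgc : ContinuousOn g G := by
    refine (h.smooth.continuousOn.mono fun x hx => hG x hx.1 hx.2).add ?_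
    exact (continuous_const.mul ((continuous_sqDist q).sub continuous_const).sqrt).continuousOn
  obtain ⟨x, hxG, hxmax⟩ := hGc.exists_isMaxOn ⟨z, hz, hzρ⟩ hgc
  have hsD : ∀ y ∈ G, √(sqDist q y - ρ) ≤ D := fun y hy =>
    Real.sqrt_le_iff.2 ⟨hD.le, by linarith [hUD y hy.1]⟩
  have hxΩ := hG x hxG.1 hxG.2
  by_cases hxf : x ∈ frontier U
  · have h1 : g z ≤ g x := hxmax ⟨hz, hzρ⟩
    have h2 := hM x hxf hxG.2
    have h3 := hsD x hxG
    have h4 : 0 ≤ (D + 2) * √(sqDist q z - ρ) := by positivity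
    have h5 : (D + 2) * √(sqDist q x - ρ) ≤ (D + 2) * D := by gcongr
    simp only [hg] at h1
    linarith
  · exfalso
    have hxU : x ∈ U := by
      by_contra hxU
      exact hxf ⟨hxG.1, by rwa [hU.interior_eq]⟩
    have hev : ∀ᶠ y in 𝓝 x, ρ ≤ sqDist q y → g y ≤ g x := by
      filter_upwards [hU.mem_nhds hxU] with y hy hyρ
      exact hxmax ⟨subset_closure hy, hyρ⟩
    rcases eq_or_lt_of_le (show ρ ≤ sqDist q x from hxG.2) with heq | hlt
    · refine h.not_isMax_on_circle hxΩ hρ heq.symm (by positivity : 0 < D + 2) ?_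
      have : g x = u x := by simp [hg, ← heq]
      rw [← this]
      exact hev
    · refine h.not_isLocalMax_add_sqrt hxΩ (hq x hxU) hρ hlt hD (hUD x hxG.1) ?_
      filter_upwards [hev, (continuous_sqDist q).continuousAt (lt_mem_nhds hlt)] with y h1 h2
      exact h1 (le_of_lt h2)

/-- **Hole filling.** If the part of the frontier of a bounded open set `U` outside of a disc
lies in `Ω`, so does the part of `U` outside of that disc, provided that the disc lies on the
correct side of `U`. -/
theorem mem_of_frontier (h : IsProperTranslator α β c Ω u) {U : Set (ℝ × ℝ)} (hU : IsOpen U)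
    (hUb : Bornology.IsBounded U) {q : ℝ × ℝ}
    (hq : ∀ x ∈ U, 0 ≤ (x.1 - q.1) * α + (x.2 - q.2) * β) {R : ℝ}
    (hfr : ∀ x ∈ frontier U, R ≤ sqDist q x → x ∈ Ω) :
    ∀ x ∈ U, R ≤ sqDist q x → x ∈ Ω := by
  by_contra! hcon
  obtain ⟨x₀, hx₀U, hx₀R, hx₀Ω⟩ := hcon
  have hclosed : IsClosed {x | R ≤ sqDist q x} :=
    isClosed_le continuous_const (continuous_sqDist q)
  have hcpt := hUb.isCompact_closure
  obtain ⟨p, ⟨⟨hpU', hpR⟩, hpΩ⟩, hpmax⟩ :=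
    ((hcpt.inter_right hclosed).diff h.isOpen).exists_isMaxOn
      ⟨x₀, ⟨subset_closure hx₀U, hx₀R⟩, hx₀Ω⟩ (continuous_sqDist q).continuousOn
  have hpR : R ≤ sqDist q p := hpR
  have hpU : p ∈ U := by
    by_contra hpU
    exact hpΩ (hfr p ⟨hpU', by rwa [hU.interior_eq]⟩ hpR)
  set F := frontier U ∩ {x | R ≤ sqDist q x} with hF
  have hFc : IsCompact F := (hcpt.of_isClosed_subset isClosed_frontier
    frontier_subset_closure).inter_right hclosed
  obtain ⟨M, hM⟩ := hFc.exists_bound_of_continuousOn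
    (h.smooth.continuousOn.mono fun x hx => hfr x hx.1 hx.2)
  obtain ⟨D₀, hD₀⟩ := hcpt.exists_bound_of_continuousOn (continuous_sqDist q).continuousOn
  set D := |D₀| + 1 with hDdef
  have hD : 0 < D := by positivity
  have hUD : ∀ x ∈ closure U, sqDist q x ≤ D ^ 2 := by
    intro x hx
    have h1 := (le_abs_self _).trans (hD₀ x hx)
    have h2 := le_abs_self D₀
    have h3 := abs_nonneg D₀
    nlinarith
  have hmem : ∀ x ∈ closure U, sqDist q p < sqDist q x → x ∈ Ω := by
    intro x hx hpx
    by_contra hxΩ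
    exact absurd (hpmax ⟨⟨hx, hpR.trans hpx.le⟩, hxΩ⟩) (not_le.2 hpx)
  have hbd : ∀ x ∈ closure U, sqDist q p < sqDist q x → |u x| ≤ M + (D + 2) * D := by
    intro x hx hpx
    have hρ : 0 < sqDist q x := (sqDist_nonneg q p).trans_lt hpx
    have hG : ∀ y ∈ closure U, sqDist q x ≤ sqDist q y → y ∈ Ω := fun y hy hxy =>
      hmem y hy (hpx.trans_le hxy)
    have hM' : ∀ y ∈ frontier U, sqDist q x ≤ sqDist q y → |u y| ≤ M := fun y hy hxy =>
      hM y ⟨hy, hpR.trans (hpx.le.trans hxy)⟩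
    rw [abs_le']
    exact ⟨h.le_of_frontier_le hU hUb hq hρ hD hUD hG
        (fun y hy hxy => (le_abs_self _).trans (hM' y hy hxy)) x hx le_rfl,
      h.neg.le_of_frontier_le hU hUb hq hρ hD hUD hG
        (fun y hy hxy => (neg_le_abs _).trans (hM' y hy hxy)) x hx le_rfl⟩
  obtain ⟨d, hd1, hd2⟩ : ∃ d : ℝ, 0 ≤ (p.1 - q.1) * d ∧ d ^ 2 = 1 := by
    rcases le_total 0 (p.1 - q.1) with h0 | h0
    · exact ⟨1, by simpa using h0, by norm_num⟩
    · exact ⟨-1, by simpa using h0, by norm_num⟩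
  have hc0 : Tendsto (fun τ : ℝ => p + τ • (d, (0 : ℝ))) (𝓝[>] 0) (𝓝 p) := by
    have := (by fun_prop : Continuous fun τ : ℝ => p + τ • (d, (0 : ℝ))).tendsto 0
    simp only [zero_smul, add_zero] at this
    exact this.mono_left nhdsWithin_le_nhds
  have hin : ∀ᶠ τ : ℝ in 𝓝[>] 0,
      p + τ • (d, (0 : ℝ)) ∈ {x | x ∈ Ω ∧ |u x| ≤ M + (D + 2) * D} := by
    filter_upwards [hc0 (hU.mem_nhds hpU), self_mem_nhdsWithin] with τ h1 h2
    have h2 : 0 < τ := h2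
    have h3 : sqDist q p < sqDist q (p + τ • (d, (0 : ℝ))) := by
      simp only [sqDist, Prod.fst_add, Prod.snd_add, Prod.smul_fst, Prod.smul_snd, smul_eq_mul]
      have h4 : 0 ≤ τ * ((p.1 - q.1) * d) := by positivity
      have h5 : 0 < τ ^ 2 * d ^ 2 := by rw [hd2]; positivity
      nlinarith
    exact ⟨hmem _ (subset_closure h1) h3, hbd _ (subset_closure h1) h3⟩
  exact hpΩ ((h.proper _).mem_of_tendsto hc0 hin).1

end IsProperTranslator

/-- A bounded set lies on the positive side of some line orthogonal to `(α, β)`. -/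
lemma exists_center_of_isBounded (α β : ℝ) {U : Set (ℝ × ℝ)}
    (hU : Bornology.IsBounded U) :
    ∃ q : ℝ × ℝ, ∀ x ∈ U, 0 ≤ (x.1 - q.1) * α + (x.2 - q.2) * β := by
  by_cases h0 : α ^ 2 + β ^ 2 = 0
  · have hα : α = 0 := by nlinarith [sq_nonneg α, sq_nonneg β]
    have hβ : β = 0 := by nlinarith [sq_nonneg α, sq_nonneg β]
    exact ⟨0, by simp [hα, hβ]⟩
  · obtain ⟨B, hB⟩ := hU.isCompact_closure.exists_bound_of_continuousOn
      (by fun_prop : Continuous fun x : ℝ × ℝ => x.1 * α + x.2 * β).continuousOn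
    refine ⟨(-(B / (α ^ 2 + β ^ 2) * α), -(B / (α ^ 2 + β ^ 2) * β)), fun x hx => ?_⟩
    have h1 := (abs_le.1 (hB x (subset_closure hx))).1
    have h2 : (x.1 - -(B / (α ^ 2 + β ^ 2) * α)) * α + (x.2 - -(B / (α ^ 2 + β ^ 2) * β)) * β
        = x.1 * α + x.2 * β + B := by
      field_simp
      ring
    simp only [h2]
    linarith

namespace IsProperTranslator

variable {α β c : ℝ} {Ω : Set (ℝ × ℝ)} {u : ℝ × ℝ → ℝ}

lemma subset_of_frontier_subset (h : IsProperTranslator α β c Ω u) {U : Set (ℝ × ℝ)}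
    (hU : IsOpen U) (hUb : Bornology.IsBounded U) (hfr : frontier U ⊆ Ω) : U ⊆ Ω := by
  obtain ⟨q, hq⟩ := exists_center_of_isBounded α β hUb
  exact fun x hx => h.mem_of_frontier hU hUb hq (R := 0) (fun y hy _ => hfr hy) x hx
    (sqDist_nonneg q x)

/-- Over a bounded domain, `u` cannot tend to `+∞` at the whole boundary. -/
lemma not_forall_isClosed_sublevel (h : IsProperTranslator α β c Ω u)
    (hb : Bornology.IsBounded Ω) (hne : Ω.Nonempty) :
    ¬ ∀ M, IsClosed {p | p ∈ Ω ∧ u p ≤ M} := by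
  intro hcl
  obtain ⟨q, hq⟩ := exists_center_of_isBounded α β hb
  obtain ⟨x₀, hx₀⟩ := hne
  obtain ⟨B, hB⟩ := hb.isCompact_closure.exists_bound_of_continuousOn
    (continuous_sqDist q).continuousOn
  have hB' : ∀ x ∈ Ω, sqDist q x ≤ B := fun x hx =>
    (le_abs_self _).trans (hB x (subset_closure hx))
  set K := {p | p ∈ Ω ∧ u p ≤ u x₀ + B}
  have hKΩ : K ⊆ Ω := fun p hp => hp.1
  have hKc : IsCompact K := isCompact_of_isClosed_isBounded (hcl _) (hb.subset hKΩ)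
  have hB0 : 0 ≤ B := (sqDist_nonneg q x₀).trans (hB' x₀ hx₀)
  have hgc : ContinuousOn (fun p => u p - sqDist q p / 2) K :=
    (h.smooth.continuousOn.mono hKΩ).sub ((continuous_sqDist q).div_const 2).continuousOn
  have hx₀K : x₀ ∈ K := ⟨hx₀, by linarith⟩
  obtain ⟨x, hxK, hmin⟩ := hKc.exists_isMinOn ⟨x₀, hx₀K⟩ hgc
  have hx := hKΩ hxK
  have hglob : ∀ z ∈ Ω, u x - sqDist q x / 2 ≤ u z - sqDist q z / 2 := by
    intro z hz
    by_cases hzK : z ∈ K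
    · exact hmin hzK
    · have h1 : u x₀ + B < u z := by
        by_contra! h1
        exact hzK ⟨hz, h1⟩
      have h2 : u x - sqDist q x / 2 ≤ u x₀ - sqDist q x₀ / 2 := hmin hx₀K
      have h3 := hB' z hz
      have h4 := sqDist_nonneg q x₀
      linarith
  have ht := h.neg.radial_touching (q := q) hx (F := fun r => -(r / 2)) (F' := fun _ => -(1 / 2))
    (F2 := 0) (Eventually.of_forall fun r => ((hasDerivAt_id r).div_const 2).neg)
    (hasDerivAt_const _ _) (by
      filter_upwards [h.isOpen.mem_nhds hx] with z hz
      have := hglob z hz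
      linarith)
  have hN := sqDist_nonneg q x
  have hY := hq x hx
  have hc := (abs_le.1 h.abs_c_le).2
  nlinarith [mul_nonneg hN hY, mul_nonneg hN (sub_nonneg.2 hc)]

end IsProperTranslator

/-- The complement of a ball in the plane is preconnected. -/
lemma isPreconnected_norm_ge {r : ℝ} (hr : 0 < r) :
    IsPreconnected {x : ℝ × ℝ | r ≤ ‖x‖} := by
  have hconn : IsConnected ({0}ᶜ : Set (ℝ × ℝ)) :=
    isConnected_compl_singleton_of_one_lt_rank (by simp; norm_num) 0
  have hcont : ContinuousOn (fun x : ℝ × ℝ => max 1 (r / ‖x‖) • x) {0}ᶜ := by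
    refine ContinuousOn.smul (continuousOn_const.sup
      (ContinuousOn.div continuousOn_const continuous_norm.continuousOn ?_)) continuousOn_id
    intro x hx
    exact norm_ne_zero_iff.2 hx
  have himg : {x : ℝ × ℝ | r ≤ ‖x‖} = (fun x : ℝ × ℝ => max 1 (r / ‖x‖) • x) '' {0}ᶜ := by
    ext y
    simp only [mem_ofPred_eq, mem_image, mem_compl_iff, mem_singleton_iff]
    constructor
    · intro hy
      have hy0 : 0 < ‖y‖ := hr.trans_le hy
      exact ⟨y, norm_pos_iff.1 hy0, by rw [max_eq_left ((div_le_one hy0).2 hy), one_smul]⟩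
    · rintro ⟨x, hx, rfl⟩
      have hx0 : 0 < ‖x‖ := norm_pos_iff.2 hx
      rw [norm_smul, Real.norm_eq_abs, abs_of_pos (lt_max_of_lt_left one_pos)]
      calc r = r / ‖x‖ * ‖x‖ := by field_simp
        _ ≤ _ := by gcongr; exact le_max_right _ _
  rw [himg]
  exact (hconn.image _ hcont).isPreconnected

namespace IsProperTranslator

variable {α β c : ℝ} {Ω : Set (ℝ × ℝ)} {u : ℝ × ℝ → ℝ}

/-- Over a bounded domain there is no continuous function on the plane which extends the sign
of `u`, vanishes only in `Ω`, and is positive near infinity. -/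
lemma false_of_sign (h : IsProperTranslator α β c Ω u) (hb : Bornology.IsBounded Ω)
    (hne : Ω.Nonempty) {Θ : ℝ × ℝ → ℝ} (hΘ : Continuous Θ) (hpos : ∀ p ∈ Ω, 0 < Θ p → 0 < u p)
    (hzero : ∀ p ∉ Ω, Θ p ≠ 0) {r : ℝ} (hinf : ∀ p, r ≤ ‖p‖ → 0 < Θ p) : False := by
  have hUsub : {p | Θ p < 0} ⊆ Ω := by
    refine h.subset_of_frontier_subset (isOpen_lt hΘ continuous_const) ?_ fun p hp => ?_
    · refine (isBounded_ball (x := (0 : ℝ × ℝ)) (r := r)).subset fun p hp => ?_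
      rw [mem_ball_zero_iff]
      by_contra! hr
      exact absurd (hinf p hr) (not_lt.2 (le_of_lt hp))
    · by_contra hpΩ
      exact hzero p hpΩ (frontier_lt_subset_eq hΘ continuous_const hp)
  have hout : ∀ p ∉ Ω, 0 < Θ p := fun p hp =>
    lt_of_le_of_ne (not_lt.1 fun hlt => hp (hUsub hlt)) (hzero p hp).symm
  refine h.not_forall_isClosed_sublevel hb hne fun M => ?_
  rw [← closure_subset_iff_isClosed]
  intro p hp
  have hΩ : p ∈ Ω := by
    by_contra hpΩ
    have hV : IsOpen {z | 0 < Θ z} := isOpen_lt continuous_const hΘ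
    have hp2 := hV.inter_closure ⟨hout p hpΩ, hp⟩
    refine hpΩ (closure_minimal ?_ (h.proper |M|) hp2).1
    rintro z ⟨hz, hzΩ, hzM⟩
    refine ⟨hzΩ, ?_⟩
    rw [abs_of_pos (hpos z hzΩ hz)]
    exact hzM.trans (le_abs_self M)
  refine ⟨hΩ, le_of_forall_pos_le_add fun ε hε => ?_⟩
  by_contra! hlt
  have hcont := h.smooth.continuousOn.continuousAt (h.isOpen.mem_nhds hΩ)
  have hnh : ∀ᶠ z in 𝓝 p, M + ε < u z := hcont.eventually (lt_mem_nhds hlt)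
  obtain ⟨z, hz1, hz2⟩ := mem_closure_iff_nhds.1 hp _ hnh
  have : u z ≤ M := hz2.2
  have : M + ε < u z := hz1
  linarith

/-- The truncated angle function descends to a continuous map to the circle on the whole
plane. -/
lemma exists_circle_map (h : IsProperTranslator α β c Ω u) :
    ∃ g : C(ℝ × ℝ, Circle), (∀ p ∈ Ω, g p = Circle.exp (π * max (-1) (min 1 (u p)))) ∧
      ∀ p ∉ Ω, g p = Circle.exp π := by
  classical
  set g : ℝ × ℝ → Circle := fun p =>
    if p ∈ Ω then Circle.exp (π * max (-1) (min 1 (u p))) else Circle.exp π with hg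
  refine ⟨⟨g, continuous_iff_continuousAt.2 fun p => ?_⟩, fun p hp => by simp [hg, hp],
    fun p hp => by simp [hg, hp]⟩
  by_cases hp : p ∈ Ω
  · have hcont := h.smooth.continuousOn.continuousAt (h.isOpen.mem_nhds hp)
    have : ContinuousAt (fun p => Circle.exp (π * max (-1) (min 1 (u p)))) p :=
      Circle.exp.continuous.continuousAt.comp
        (continuousAt_const.mul (continuousAt_const.max (continuousAt_const.min hcont)))
    refine this.congr ?_
    filter_upwards [h.isOpen.mem_nhds hp] with z hz
    simp [hg, hz]
  · have hnh := (h.proper 1).isOpen_compl.mem_nhds (fun hp' => hp hp'.1 : p ∈ _)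
    refine (continuousAt_const (y := Circle.exp π)).congr ?_
    filter_upwards [hnh] with z hz
    by_cases hzΩ : z ∈ Ω
    · have hz1 : 1 < |u z| := by
        by_contra! hle
        exact hz ⟨hzΩ, hle⟩
      simp only [hg, hzΩ, if_true]
      rcases lt_abs.1 hz1 with h1 | h1
      · rw [min_eq_left h1.le, max_eq_right (by norm_num), mul_one]
      · rw [min_eq_right (by linarith), max_eq_left (by linarith)]
        exact Circle.exp_eq_exp.2 ⟨1, by push_cast; ring⟩
    · simp [hg, hzΩ]

/-- A proper translating graph with connected domain has an angle function on the whole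
plane. -/
lemma exists_angle (h : IsProperTranslator α β c Ω u) (hconn : IsConnected Ω) :
    ∃ Θ : ℝ × ℝ → ℝ, Continuous Θ ∧ (∀ p ∈ Ω, Θ p = π * max (-1) (min 1 (u p))) ∧
      ∀ p ∉ Ω, Θ p ≠ 0 := by
  obtain ⟨g, hgΩ, hgc⟩ := h.exists_circle_map
  obtain ⟨p₀, hp₀⟩ := hconn.nonempty
  obtain ⟨f, ⟨hf0, hf⟩, -⟩ := Circle.isCoveringMap_exp.existsUnique_continuousMap_lifts g
    (a₀ := p₀) (e₀ := π * max (-1) (min 1 (u p₀))) (hgΩ p₀ hp₀).symm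
  have hf : ∀ p, Circle.exp (f p) = g p := fun p => congrFun hf p
  have hπ := Real.pi_pos
  refine ⟨f, f.continuous, fun p hp => ?_, fun p hp h0 => ?_⟩
  · have hcu : ContinuousOn (fun p => (f p - π * max (-1) (min 1 (u p))) / (2 * π)) Ω :=
      ((f.continuous.continuousOn).sub (continuousOn_const.mul (continuousOn_const.sup
        (continuousOn_const.inf h.smooth.continuousOn)))).div_const _
    have hint : ∀ p ∈ Ω, ∃ m : ℤ, (f p - π * max (-1) (min 1 (u p))) / (2 * π) = m := by
      intro p hp
      obtain ⟨m, hm⟩ := Circle.exp_eq_exp.1 ((hf p).trans (hgΩ p hp))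
      exact ⟨m, by rw [hm]; field_simp; ring⟩
    have h0 : (f p₀ - π * max (-1) (min 1 (u p₀))) / (2 * π) = 0 := by simp [hf0]
    have hhalf : ∀ q ∈ Ω, ∀ m : ℤ,
        (f q - π * max (-1) (min 1 (u q))) / (2 * π) ≠ m + 1 / 2 := by
      intro q hq m hm
      obtain ⟨k, hk⟩ := hint q hq
      have h1 : (2 * k : ℝ) = 2 * m + 1 := by rw [hk] at hm; linarith
      have h2 : 2 * k = 2 * m + 1 := by exact_mod_cast h1
      omega
    obtain ⟨m, hm⟩ := hint p hp
    have hm0 : m = 0 := by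
      rcases lt_trichotomy m 0 with hlt | heq | hgt
      · have h1 : (m : ℝ) ≤ -1 := by exact_mod_cast (by omega : m ≤ -1)
        obtain ⟨z, hz, hz'⟩ := hconn.isPreconnected.intermediate_value hp hp₀ hcu
          (show (((-1 : ℤ) : ℝ) + 1 / 2) ∈ _ from
            ⟨by rw [hm]; push_cast; linarith, by rw [h0]; norm_num⟩)
        exact absurd hz' (hhalf z hz _)
      · exact heq
      · have h1 : (1 : ℝ) ≤ m := by exact_mod_cast hgt
        obtain ⟨z, hz, hz'⟩ := hconn.isPreconnected.intermediate_value hp₀ hp hcu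
          (show (((0 : ℤ) : ℝ) + 1 / 2) ∈ _ from
            ⟨by rw [h0]; norm_num, by rw [hm]; push_cast; linarith⟩)
        exact absurd hz' (hhalf z hz _)
    rw [hm0, Int.cast_zero, div_eq_zero_iff] at hm
    have := hm.resolve_right (by positivity)
    linarith
  · obtain ⟨m, hm⟩ := Circle.exp_eq_exp.1 ((hf p).trans (hgc p hp))
    rw [h0] at hm
    have h1 : (1 + 2 * m : ℝ) * π = 0 := by linarith
    have h2 : (1 + 2 * m : ℝ) = 0 := (mul_eq_zero.1 h1).resolve_right hπ.ne'
    have h3 : 1 + 2 * m = 0 := by exact_mod_cast h2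
    omega

/-- The domain of a proper translating graph is unbounded. -/
theorem not_isBounded (h : IsProperTranslator α β c Ω u) (hconn : IsConnected Ω) :
    ¬ Bornology.IsBounded Ω := by
  intro hb
  obtain ⟨Θ, hΘ, hΘΩ, hΘ0⟩ := h.exists_angle hconn
  obtain ⟨r, hr0, hr⟩ := hb.exists_pos_norm_lt
  have hout : ∀ p, r ≤ ‖p‖ → Θ p ≠ 0 := fun p hp => hΘ0 p fun hpΩ => absurd (hr p hpΩ) (not_lt.2 hp)
  have hπ := Real.pi_pos
  have hsign : ∀ p ∈ Ω, (0 < Θ p → 0 < u p) ∧ (0 < -Θ p → 0 < -u p) := by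
    intro p hp
    rw [hΘΩ p hp]
    refine ⟨fun h1 => ?_, fun h1 => ?_⟩
    · have h2 : 0 < max (-1) (min 1 (u p)) := (mul_pos_iff_of_pos_left hπ).1 h1
      rcases lt_max_iff.1 h2 with h3 | h3
      · linarith
      · exact (lt_min_iff.1 h3).2
    · by_contra! h2
      have : 0 ≤ π * max (-1) (min 1 (u p)) :=
        mul_nonneg hπ.le (le_max_of_le_right (le_min zero_le_one (by linarith)))
      linarith
  have hdich : (∀ p, r ≤ ‖p‖ → 0 < Θ p) ∨ ∀ p, r ≤ ‖p‖ → 0 < -Θ p := by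
    by_contra! hcon
    obtain ⟨⟨p, hp, hp'⟩, q, hq, hq'⟩ := hcon
    obtain ⟨z, hz, hz'⟩ := (isPreconnected_norm_ge hr0).intermediate_value hp hq
      hΘ.continuousOn ⟨hp', by linarith⟩
    exact hout z hz hz'
  rcases hdich with hd | hd
  · exact h.false_of_sign hb hconn.nonempty hΘ (fun p hp => (hsign p hp).1) hΘ0 hd
  · exact h.neg.false_of_sign hb hconn.nonempty hΘ.neg (fun p hp => (hsign p hp).2)
      (fun p hp => neg_ne_zero.2 (hΘ0 p hp)) hd

end IsProperTranslator

/-- A planar domain has the downward filling property if a bounded open set can be filled, away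
from any disc centred below it, as soon as its frontier away from the disc lies in the
domain. -/
structure HasFilling (D : Set (ℝ × ℝ)) : Prop where
  isOpen : IsOpen D
  fill : ∀ U : Set (ℝ × ℝ), IsOpen U → Bornology.IsBounded U → ∀ (q : ℝ × ℝ) (R : ℝ),
    (∀ x ∈ U, q.2 ≤ x.2) → (∀ x ∈ frontier U, R ≤ sqDist q x → x ∈ D) →
      ∀ x ∈ U, R ≤ sqDist q x → x ∈ D

/-- The trapezoid between the lines `x = l₀ + l₁ y` and `x = r₀ + r₁ y` in a horizontal strip. -/
def trapezoid (l₀ l₁ r₀ r₁ m h : ℝ) : Set (ℝ × ℝ) :=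
  {z | m ≤ z.2 ∧ z.2 ≤ h ∧ l₀ + l₁ * z.2 ≤ z.1 ∧ z.1 ≤ r₀ + r₁ * z.2}

lemma convex_trapezoid (l₀ l₁ r₀ r₁ m h : ℝ) : Convex ℝ (trapezoid l₀ l₁ r₀ r₁ m h) := by
  rintro ⟨x, y⟩ ⟨h1, h2, h3, h4⟩ ⟨x', y'⟩ ⟨h1', h2', h3', h4'⟩ s t hs ht hst
  obtain rfl : s = 1 - t := by linarith
  simp only [trapezoid, Prod.smul_mk, Prod.mk_add_mk, smul_eq_mul, mem_ofPred_eq] at *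
  have key : ∀ {A B : ℝ}, 0 ≤ A → 0 ≤ B → 0 ≤ (1 - t) * A + t * B := fun hA hB => by positivity
  refine ⟨?_, ?_, ?_, ?_⟩
  · linarith [key (sub_nonneg.2 h1) (sub_nonneg.2 h1')]
  · linarith [key (sub_nonneg.2 h2) (sub_nonneg.2 h2')]
  · linarith [key (sub_nonneg.2 h3) (sub_nonneg.2 h3')]
  · linarith [key (sub_nonneg.2 h4) (sub_nonneg.2 h4')]

lemma isClosed_trapezoid (l₀ l₁ r₀ r₁ m h : ℝ) : IsClosed (trapezoid l₀ l₁ r₀ r₁ m h) := by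
  change IsClosed ({z : ℝ × ℝ | m ≤ z.2} ∩ ({z | z.2 ≤ h} ∩
    ({z | l₀ + l₁ * z.2 ≤ z.1} ∩ {z | z.1 ≤ r₀ + r₁ * z.2})))
  exact (isClosed_le (by fun_prop) (by fun_prop)).inter
    ((isClosed_le (by fun_prop) (by fun_prop)).inter
      ((isClosed_le (by fun_prop) (by fun_prop)).inter
        (isClosed_le (by fun_prop) (by fun_prop))))

namespace HasFilling

variable {D : Set (ℝ × ℝ)}

lemma mem_of_strip (hD : HasFilling D) {l₀ l₁ r₀ r₁ m h : ℝ}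
    (hL : ∀ y ∈ Ioc m h, (l₀ + l₁ * y, y) ∈ D) (hR : ∀ y ∈ Ioc m h, (r₀ + r₁ * y, y) ∈ D)
    (htop : ∀ x, l₀ + l₁ * h ≤ x → x ≤ r₀ + r₁ * h → (x, h) ∈ D) {z : ℝ × ℝ}
    (hz : z ∈ trapezoid l₀ l₁ r₀ r₁ m h) (hmz : m < z.2) : z ∈ D := by
  obtain ⟨x₀, y₀⟩ := z
  obtain ⟨-, h2, h3, h4⟩ := hz
  simp only at h2 h3 h4 hmz
  rcases eq_or_lt_of_le h2 with rfl | h2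
  · exact htop _ h3 h4
  rcases eq_or_lt_of_le h3 with rfl | h3
  · exact hL _ ⟨hmz, h2.le⟩
  rcases eq_or_lt_of_le h4 with rfl | h4
  · exact hR _ ⟨hmz, h2.le⟩
  set U : Set (ℝ × ℝ) :=
    {z | m < z.2} ∩ {z | z.2 < h} ∩ {z | l₀ + l₁ * z.2 < z.1} ∩ {z | z.1 < r₀ + r₁ * z.2} with hUdef
  have hU : IsOpen U :=
    (((isOpen_lt (by fun_prop) (by fun_prop)).inter (isOpen_lt (by fun_prop) (by fun_prop))).inter
      (isOpen_lt (by fun_prop) (by fun_prop))).inter (isOpen_lt (by fun_prop) (by fun_prop))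
  have hcl : closure U ⊆ trapezoid l₀ l₁ r₀ r₁ m h := by
    refine closure_minimal ?_ ?_
    · rintro z ⟨⟨⟨a1, a2⟩, a3⟩, a4⟩
      exact ⟨le_of_lt a1, le_of_lt a2, le_of_lt a3, le_of_lt a4⟩
    · exact isClosed_trapezoid ..
  set Y := max |m| |h| with hY
  set B := |l₀| + |l₁| * Y + |r₀| + |r₁| * Y with hB
  have hbd : ∀ z ∈ trapezoid l₀ l₁ r₀ r₁ m h, |z.2| ≤ Y ∧ |z.1| ≤ B := by
    rintro z ⟨a1, a2, a3, a4⟩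
    have hy : |z.2| ≤ Y := abs_le_max_abs_abs a1 a2
    have b1 : |l₁ * z.2| ≤ |l₁| * Y := by rw [abs_mul]; gcongr
    have b2 : |r₁ * z.2| ≤ |r₁| * Y := by rw [abs_mul]; gcongr
    have b3 := abs_nonneg l₀
    have b4 := abs_nonneg r₀
    have b5 := abs_nonneg (l₁ * z.2)
    have b6 := abs_nonneg (r₁ * z.2)
    have b7 := neg_abs_le l₀
    have b8 := le_abs_self r₀
    have b9 := neg_abs_le (l₁ * z.2)
    have b10 := le_abs_self (r₁ * z.2)
    exact ⟨hy, abs_le.2 ⟨by linarith, by linarith⟩⟩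
  have hUb : Bornology.IsBounded U := by
    refine isBounded_iff_forall_norm_le.2 ⟨max B Y, fun z hz => ?_⟩
    have := hbd z (hcl (subset_closure hz))
    rw [Prod.norm_def, Real.norm_eq_abs, Real.norm_eq_abs]
    exact max_le_max this.2 this.1
  have hδ : 0 < y₀ - m := by linarith
  set T := (B ^ 2 + (y₀ - m) ^ 2) / (y₀ - m) with hT
  have hTδ : T * (y₀ - m) = B ^ 2 + (y₀ - m) ^ 2 := by rw [hT]; field_simp
  have hTle : y₀ - m ≤ T := by
    rw [hT, le_div_iff₀ hδ]; nlinarith [sq_nonneg B]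
  refine hD.fill U hU hUb (0, y₀ - T) (T ^ 2) ?_ ?_ (x₀, y₀) ⟨⟨⟨hmz, h2⟩, h3⟩, h4⟩ ?_
  · rintro z ⟨⟨⟨a1, -⟩, -⟩, -⟩
    have a1 : m < z.2 := a1
    simp only
    linarith
  · rintro ⟨x, y⟩ hz hTz
    have hzt := hcl (frontier_subset_closure hz)
    have hzU : (x, y) ∉ U := fun hzU => hz.2 (by rwa [hU.interior_eq])
    have hx := abs_le.1 (hbd _ hzt).2
    obtain ⟨a1, a2, a3, a4⟩ := hzt
    simp only [sqDist] at a1 a2 a3 a4 hx hTz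
    rcases eq_or_lt_of_le a1 with rfl | a1
    · nlinarith
    rcases eq_or_lt_of_le a2 with rfl | a2
    · exact htop _ a3 a4
    rcases eq_or_lt_of_le a3 with rfl | a3
    · exact hL _ ⟨a1, a2.le⟩
    rcases eq_or_lt_of_le a4 with rfl | a4
    · exact hR _ ⟨a1, a2.le⟩
    exact absurd ⟨⟨⟨a1, a2⟩, a3⟩, a4⟩ hzU
  · simp only [sqDist]
    nlinarith [sq_nonneg x₀]

/-- A trapezoid is contained in the domain as soon as its top and its sides are. -/
lemma trapezoid_subset (hD : HasFilling D) {l₀ l₁ r₀ r₁ m h : ℝ}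
    (hL : ∀ y ∈ Icc m h, (l₀ + l₁ * y, y) ∈ D) (hR : ∀ y ∈ Icc m h, (r₀ + r₁ * y, y) ∈ D)
    (htop : ∀ x, l₀ + l₁ * h ≤ x → x ≤ r₀ + r₁ * h → (x, h) ∈ D) :
    trapezoid l₀ l₁ r₀ r₁ m h ⊆ D := by
  intro z hz
  have hmh : m ≤ h := hz.1.trans hz.2.1
  have hext : ∀ a b : ℝ, (a + b * m, m) ∈ D → ∀ᶠ y in 𝓝 m, (a + b * y, y) ∈ D := by
    intro a b hab
    exact (by fun_prop : Continuous fun y : ℝ => (a + b * y, y)).continuousAt.eventually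
      (hD.isOpen.mem_nhds hab)
  obtain ⟨ε, hε, hball⟩ := Metric.eventually_nhds_iff.1
    ((hext _ _ (hL m ⟨le_rfl, hmh⟩)).and (hext _ _ (hR m ⟨le_rfl, hmh⟩)))
  have hnear : ∀ y ∈ Ioc (m - ε) h, y < m → (l₀ + l₁ * y, y) ∈ D ∧ (r₀ + r₁ * y, y) ∈ D := by
    intro y hy hym
    exact hball (by rw [Real.dist_eq, abs_lt]; constructor <;> linarith [hy.1])
  obtain ⟨h1, h2, h3, h4⟩ := hz
  refine hD.mem_of_strip (m := m - ε) (fun y hy => ?_) (fun y hy => ?_) htop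
    (⟨by linarith, h2, h3, h4⟩ : z ∈ trapezoid l₀ l₁ r₀ r₁ (m - ε) h) (by linarith)
  · rcases lt_or_ge y m with hym | hym
    · exact (hnear y hy hym).1
    · exact hL y ⟨hym, hy.2⟩
  · rcases lt_or_ge y m with hym | hym
    · exact (hnear y hy hym).2
    · exact hR y ⟨hym, hy.2⟩

end HasFilling

lemma mem_segment_affine {l₀ l₁ m h y : ℝ} (hm : m ≤ y) (hh : y ≤ h) :
    (l₀ + l₁ * y, y) ∈ segment ℝ (l₀ + l₁ * m, m) (l₀ + l₁ * h, h) := by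
  obtain ⟨s, t, hs, ht, hst, rfl⟩ : y ∈ segment ℝ m h := by
    rw [segment_eq_Icc (hm.trans hh)]; exact ⟨hm, hh⟩
  refine ⟨s, t, hs, ht, hst, ?_⟩
  simp only [Prod.smul_mk, Prod.mk_add_mk, smul_eq_mul, Prod.mk.injEq, and_true]
  linear_combination l₀ * hst

lemma mem_segment_horizontal {a b x h : ℝ} (ha : a ≤ x) (hb : x ≤ b) :
    (x, h) ∈ segment ℝ (a, h) (b, h) := by
  rw [← Prod.image_mk_segment_left, segment_eq_Icc (ha.trans hb)]
  exact ⟨x, ⟨ha, hb⟩, rfl⟩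

/-- A group valued function of pairs of points is a cocycle on `D` if it is additive along
triangles with vertices in a convex subset of `D`. -/
def IsCocycle {Γ : Type*} [Group Γ] (D : Set (ℝ × ℝ)) (G : ℝ × ℝ → ℝ × ℝ → Γ) : Prop :=
  ∀ C ⊆ D, Convex ℝ C → ∀ p ∈ C, ∀ q ∈ C, ∀ r ∈ C, G p q * G q r = G p r

namespace IsCocycle

variable {Γ : Type*} [Group Γ] {D : Set (ℝ × ℝ)} {G : ℝ × ℝ → ℝ × ℝ → Γ} {p q r : ℝ × ℝ}

lemma self (hG : IsCocycle D G) (hp : p ∈ D) : G p p = 1 :=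
  mul_eq_left.1 (hG {p} (by simpa using hp) (convex_singleton p) p rfl p rfl p rfl)

lemma symm (hG : IsCocycle D G) (h : segment ℝ p q ⊆ D) : G q p = (G p q)⁻¹ := by
  have hp := left_mem_segment ℝ p q
  have hq := right_mem_segment ℝ p q
  rw [eq_inv_iff_mul_eq_one, hG _ h (convex_segment p q) q hq p hp q hq, hG.self (h hq)]

lemma mul_of_mem_segment (hG : IsCocycle D G) (h : segment ℝ p r ⊆ D)
    (hq : q ∈ segment ℝ p r) : G p q * G q r = G p r :=
  hG _ h (convex_segment p r) _ (left_mem_segment ℝ p r) _ hq _ (right_mem_segment ℝ p r)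

lemma horizontal_trans (hG : IsCocycle D G) {a b c k : ℝ}
    (hab : segment ℝ (a, k) (b, k) ⊆ D) (hbc : segment ℝ (b, k) (c, k) ⊆ D) :
    segment ℝ (a, k) (c, k) ⊆ D ∧ G (a, k) (b, k) * G (b, k) (c, k) = G (a, k) (c, k) := by
  set A : Set ℝ := segment ℝ a b ∪ segment ℝ b c with hA
  have hAc : Convex ℝ A := by
    have h1 : IsPreconnected A := IsPreconnected.union b (right_mem_segment ℝ a b)
      (left_mem_segment ℝ b c) (convex_segment a b).isPreconnected
      (convex_segment b c).isPreconnected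
    exact h1.ordConnected.convex
  have hsub : (fun x => (x, k)) '' A ⊆ D := by
    rw [hA, image_union, Prod.image_mk_segment_left, Prod.image_mk_segment_left]
    exact union_subset hab hbc
  have hconv : Convex ℝ ((fun x => (x, k)) '' A) := by
    rw [← prod_singleton]
    exact hAc.prod (convex_singleton k)
  have ha : (a, k) ∈ (fun x => (x, k)) '' A := ⟨a, .inl (left_mem_segment ℝ a b), rfl⟩
  have hb : (b, k) ∈ (fun x => (x, k)) '' A := ⟨b, .inl (right_mem_segment ℝ a b), rfl⟩
  have hc : (c, k) ∈ (fun x => (x, k)) '' A := ⟨c, .inr (right_mem_segment ℝ b c), rfl⟩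
  exact ⟨(hconv.segment_subset ha hc).trans hsub, hG _ hsub hconv _ ha _ hb _ hc⟩

/-- The four point relation, for a top edge oriented to the right. -/
lemma four_point_aux (hG : IsCocycle D G) (hD : HasFilling D) {l₀ l₁ r₀ r₁ m h : ℝ} (hmh : m < h)
    (hle : l₀ + l₁ * h ≤ r₀ + r₁ * h)
    (hL : segment ℝ (l₀ + l₁ * m, m) (l₀ + l₁ * h, h) ⊆ D)
    (htop : segment ℝ (l₀ + l₁ * h, h) (r₀ + r₁ * h, h) ⊆ D)
    (hR : segment ℝ (r₀ + r₁ * m, m) (r₀ + r₁ * h, h) ⊆ D) :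
    segment ℝ (l₀ + l₁ * m, m) (r₀ + r₁ * m, m) ⊆ D ∧
      G (l₀ + l₁ * m, m) (l₀ + l₁ * h, h) * G (l₀ + l₁ * h, h) (r₀ + r₁ * h, h)
        * G (r₀ + r₁ * h, h) (r₀ + r₁ * m, m) = G (l₀ + l₁ * m, m) (r₀ + r₁ * m, m) := by
  have hL' : ∀ y ∈ Icc m h, (l₀ + l₁ * y, y) ∈ D := fun y hy => hL (mem_segment_affine hy.1 hy.2)
  have hR' : ∀ y ∈ Icc m h, (r₀ + r₁ * y, y) ∈ D := fun y hy => hR (mem_segment_affine hy.1 hy.2)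
  have htop' : ∀ x, l₀ + l₁ * h ≤ x → x ≤ r₀ + r₁ * h → (x, h) ∈ D := fun x h1 h2 =>
    htop (mem_segment_horizontal h1 h2)
  rcases le_or_gt (l₀ + l₁ * m) (r₀ + r₁ * m) with hb | hb
  · have hsub := hD.trapezoid_subset hL' hR' htop'
    have hconv := convex_trapezoid l₀ l₁ r₀ r₁ m h
    have mq : (l₀ + l₁ * m, m) ∈ trapezoid l₀ l₁ r₀ r₁ m h := ⟨le_rfl, hmh.le, le_rfl, hb⟩
    have mr : (r₀ + r₁ * m, m) ∈ trapezoid l₀ l₁ r₀ r₁ m h := ⟨le_rfl, hmh.le, hb, le_rfl⟩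
    have mp : (l₀ + l₁ * h, h) ∈ trapezoid l₀ l₁ r₀ r₁ m h := ⟨hmh.le, le_rfl, le_rfl, hle⟩
    have mp' : (r₀ + r₁ * h, h) ∈ trapezoid l₀ l₁ r₀ r₁ m h := ⟨hmh.le, le_rfl, hle, le_rfl⟩
    refine ⟨(hconv.segment_subset mq mr).trans hsub, ?_⟩
    rw [hG _ hsub hconv _ mq _ mp _ mp', hG _ hsub hconv _ mq _ mp' _ mr]
  · have hslope : 0 < r₁ - l₁ := by
      by_contra! hneg
      nlinarith
    obtain ⟨y, hy⟩ : ∃ y, l₀ + l₁ * y = r₀ + r₁ * y :=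
      ⟨(l₀ - r₀) / (r₁ - l₁), by field_simp; ring⟩
    have hmy : m ≤ y := by
      by_contra! hlt
      nlinarith
    have hyh : y ≤ h := by
      by_contra! hlt
      nlinarith
    have up : trapezoid l₀ l₁ r₀ r₁ y h ⊆ D := hD.trapezoid_subset
      (fun z hz => hL' z ⟨hmy.trans hz.1, hz.2⟩) (fun z hz => hR' z ⟨hmy.trans hz.1, hz.2⟩) htop'
    have low : trapezoid r₀ r₁ l₀ l₁ m y ⊆ D := hD.trapezoid_subset
      (fun z hz => hR' z ⟨hz.1, hz.2.trans hyh⟩) (fun z hz => hL' z ⟨hz.1, hz.2.trans hyh⟩)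
      (fun x h1 h2 => by
        obtain rfl : x = l₀ + l₁ * y := by linarith
        exact hL' y ⟨hmy, hyh⟩)
    have oL : (l₀ + l₁ * y, y) ∈ segment ℝ (l₀ + l₁ * m, m) (l₀ + l₁ * h, h) :=
      mem_segment_affine hmy hyh
    have oR : (l₀ + l₁ * y, y) ∈ segment ℝ (r₀ + r₁ * h, h) (r₀ + r₁ * m, m) := by
      rw [hy, segment_symm]; exact mem_segment_affine hmy hyh
    have mo : (l₀ + l₁ * y, y) ∈ trapezoid l₀ l₁ r₀ r₁ y h := ⟨le_rfl, hyh, le_rfl, hy.le⟩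
    have mp : (l₀ + l₁ * h, h) ∈ trapezoid l₀ l₁ r₀ r₁ y h := ⟨hyh, le_rfl, le_rfl, hle⟩
    have mp' : (r₀ + r₁ * h, h) ∈ trapezoid l₀ l₁ r₀ r₁ y h := ⟨hyh, le_rfl, hle, le_rfl⟩
    have no : (l₀ + l₁ * y, y) ∈ trapezoid r₀ r₁ l₀ l₁ m y := ⟨hmy, le_rfl, hy.ge, le_rfl⟩
    have nq : (l₀ + l₁ * m, m) ∈ trapezoid r₀ r₁ l₀ l₁ m y := ⟨le_rfl, hmy, hb.le, le_rfl⟩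
    have nr : (r₀ + r₁ * m, m) ∈ trapezoid r₀ r₁ l₀ l₁ m y := ⟨le_rfl, hmy, le_rfl, hb.le⟩
    have cu := convex_trapezoid l₀ l₁ r₀ r₁ y h
    have cl := convex_trapezoid r₀ r₁ l₀ l₁ m y
    refine ⟨(cl.segment_subset nq nr).trans low, ?_⟩
    rw [segment_symm] at hR
    rw [← hG.mul_of_mem_segment hL oL, ← hG.mul_of_mem_segment hR oR,
      mul_assoc (G _ _), hG _ up cu _ mo _ mp _ mp', mul_assoc, ← mul_assoc (G (_, y) _),
      hG _ up cu _ mo _ mp' _ mo, hG.self (up mo), one_mul, hG _ low cl _ nq _ no _ nr]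

/-- **Four point relation.** The bottom edge of a quadrilateral with horizontal top and bottom
edges is in `D` if the three other edges are, and the cocycle relation holds around it. -/
lemma four_point (hG : IsCocycle D G) (hD : HasFilling D) {a a' b b' m h : ℝ} (hmh : m < h)
    (hL : segment ℝ (b, m) (a, h) ⊆ D) (htop : segment ℝ (a, h) (a', h) ⊆ D)
    (hR : segment ℝ (a', h) (b', m) ⊆ D) :
    segment ℝ (b, m) (b', m) ⊆ D ∧
      G (b, m) (a, h) * G (a, h) (a', h) * G (a', h) (b', m) = G (b, m) (b', m) := by
  have key : ∀ {a a' b b' : ℝ}, a ≤ a' → segment ℝ (b, m) (a, h) ⊆ D →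
      segment ℝ (a, h) (a', h) ⊆ D → segment ℝ (b', m) (a', h) ⊆ D →
      segment ℝ (b, m) (b', m) ⊆ D ∧
        G (b, m) (a, h) * G (a, h) (a', h) * G (a', h) (b', m) = G (b, m) (b', m) := by
    intro a a' b b' hle
    have hne : h - m ≠ 0 := (sub_pos.2 hmh).ne'
    have line : ∀ s t : ℝ, ∃ l₀ l₁, t = l₀ + l₁ * m ∧ s = l₀ + l₁ * h := fun s t =>
      ⟨t - (s - t) / (h - m) * m, (s - t) / (h - m), by ring, by field_simp; ring⟩
    obtain ⟨l₀, l₁, rfl, rfl⟩ := line a b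
    obtain ⟨r₀, r₁, rfl, rfl⟩ := line a' b'
    exact hG.four_point_aux hD hmh hle
  have hR' : segment ℝ (b', m) (a', h) ⊆ D := by rwa [segment_symm]
  rcases le_total a a' with hle | hle
  · exact key hle hL htop hR'
  · obtain ⟨h1, h2⟩ := key hle hR' (by rwa [segment_symm]) hL
    rw [segment_symm] at h1
    refine ⟨h1, ?_⟩
    rw [hG.symm h1, hG.symm hL, hG.symm htop, hG.symm hR] at h2
    rw [← inv_inj, ← h2]
    group

/-- A polygonal chain with vertices on equidistant horizontal lines, which starts and ends at
its lowest level, can be replaced with the segment between its endpoints. -/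
lemma chain_eq (hG : IsCocycle D G) (hD : HasFilling D) {δ : ℝ} (hδ : 0 < δ) {x : ℕ → ℝ}
    {k : ℕ → ℤ} (hk : ∀ i, |k (i + 1) - k i| ≤ 1)
    (hseg : ∀ i, segment ℝ (x i, δ * k i) (x (i + 1), δ * k (i + 1)) ⊆ D) {P : ℕ → Γ}
    (hP : ∀ i, P (i + 1) = P i * G (x i, δ * k i) (x (i + 1), δ * k (i + 1))) (n : ℕ) :
    ∀ i, k (i + n) = k i → (∀ j ≤ n, k i ≤ k (i + j)) →
      segment ℝ (x i, δ * k i) (x (i + n), δ * k i) ⊆ D ∧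
        P (i + n) = P i * G (x i, δ * k i) (x (i + n), δ * k i) := by
  induction n using Nat.strong_induction_on with
  | _ n ih =>
    intro i hn hj
    have hi : (x i, δ * (k i : ℝ)) ∈ D := hseg i (left_mem_segment ..)
    by_cases hmid : ∃ j, 0 < j ∧ j < n ∧ k (i + j) = k i
    · obtain ⟨j, hj0, hjn, hkj⟩ := hmid
      obtain ⟨s1, e1⟩ := ih j hjn i hkj fun l hl => hj l (hl.trans hjn.le)
      obtain ⟨s2, e2⟩ := ih (n - j) (by omega) (i + j)
        (by rw [hkj, add_assoc, Nat.add_sub_cancel' hjn.le, hn])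
        (fun l hl => by rw [hkj, add_assoc]; exact hj _ (by omega))
      rw [hkj, add_assoc, Nat.add_sub_cancel' hjn.le] at s2 e2
      obtain ⟨s3, e3⟩ := hG.horizontal_trans s1 s2
      exact ⟨s3, by rw [e2, e1, mul_assoc, e3]⟩
    push Not at hmid
    match n, ih, hn, hj, hmid with
    | 0, _, _, _, _ =>
      rw [add_zero, segment_same, hG.self hi, mul_one]
      exact ⟨by simpa using hi, rfl⟩
    | 1, _, hn, _, _ =>
      have s1 := hseg i
      have e1 := hP i
      rw [hn] at s1 e1
      exact ⟨s1, e1⟩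
    | n + 2, ih, hn, hj, hmid =>
      have hup : ∀ j, 0 < j → j < n + 2 → k i + 1 ≤ k (i + j) := fun j h1 h2 => by
        have h3 := hj j h2.le
        have h4 := hmid j h1 h2
        omega
      have h1 : k (i + 1) = k i + 1 := by
        have h2 := hup 1 one_pos (by omega)
        have h3 := (abs_le.1 (hk i)).2
        omega
      have h2 : k (i + 1 + n) = k i + 1 := by
        have h2 := hup (n + 1) (by omega) (by omega)
        have h3 := (abs_le.1 (hk (i + 1 + n))).1
        rw [show i + 1 + n + 1 = i + (n + 2) by omega, hn] at h3
        rw [show i + (n + 1) = i + 1 + n by omega] at h2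
        omega
      obtain ⟨s1, e1⟩ := ih n (by omega) (i + 1) (by rw [h1, h2]) fun j hjn => by
        rw [h1, add_assoc]
        exact hup _ (by omega) (by omega)
      have s0 := hseg i
      have e0 := hP i
      have s2 := hseg (i + 1 + n)
      have e2 := hP (i + 1 + n)
      rw [h1] at s0 e0 s1 e1
      rw [show i + 1 + n + 1 = i + (n + 2) by omega, hn, h2] at s2 e2
      have hlt : δ * (k i : ℝ) < δ * ((k i + 1 : ℤ) : ℝ) := by
        push_cast; nlinarith
      obtain ⟨s3, e3⟩ := hG.four_point hD hlt s0 s1 s2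
      refine ⟨s3, ?_⟩
      rw [e2, e1, e0, ← e3]
      group

/-- The product of a cocycle along a closed polygonal chain with vertices on equidistant
horizontal lines is trivial. -/
lemma closed_chain_eq_one (hG : IsCocycle D G) (hD : HasFilling D) {δ : ℝ} (hδ : 0 < δ) {n : ℕ}
    (hn : 0 < n) {x : ℕ → ℝ} {k : ℕ → ℤ} (hx : x n = x 0) (hkn : k n = k 0)
    (hk : ∀ i < n, |k (i + 1) - k i| ≤ 1)
    (hseg : ∀ i < n, segment ℝ (x i, δ * k i) (x (i + 1), δ * k (i + 1)) ⊆ D) {P : ℕ → Γ}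
    (hP0 : P 0 = 1)
    (hP : ∀ i < n, P (i + 1) = P i * G (x i, δ * k i) (x (i + 1), δ * k (i + 1))) :
    P n = 1 := by
  have hlt : ∀ i, i % n < n := fun i => Nat.mod_lt i hn
  have hstep : ∀ {α : Type} (f : ℕ → α), f n = f 0 → ∀ i, f ((i + 1) % n) = f (i % n + 1) := by
    intro α f hf i
    rw [← Nat.mod_add_mod]
    rcases Nat.lt_or_eq_of_le (hlt i) with h | h
    · rw [Nat.mod_eq_of_lt h]
    · rw [show i % n + 1 = n from h, Nat.mod_self, hf]
  set Q : ℕ → Γ := fun i => Nat.rec 1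
    (fun i g => g * G (x (i % n), δ * k (i % n)) (x ((i + 1) % n), δ * k ((i + 1) % n))) i with hQ
  have hQs : ∀ i, Q (i + 1) =
    Q i * G (x (i % n), δ * k (i % n)) (x ((i + 1) % n), δ * k ((i + 1) % n)) := fun i => rfl
  have hQP : ∀ i ≤ n, Q i = P i := by
    intro i
    induction i with
    | zero => exact fun _ => hP0.symm
    | succ i ih =>
      intro hi
      rw [hQs, ih (by omega), hP i hi, hstep x hx, hstep k hkn, Nat.mod_eq_of_lt hi]
  have hQadd : ∀ i, Q (n + i) = Q n * Q i := by
    intro i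
    induction i with
    | zero => simp [hQ]
    | succ i ih =>
      rw [← add_assoc, hQs, ih, hQs, mul_assoc, add_assoc n i 1, Nat.add_mod_left,
        Nat.add_mod_left]
  obtain ⟨m, hm, hmin⟩ := Finset.exists_min_image (Finset.range n) k ⟨0, by simpa using hn⟩
  have hm : m < n := Finset.mem_range.1 hm
  have hmm : (m + n) % n = m := by rw [Nat.add_mod_right, Nat.mod_eq_of_lt hm]
  obtain ⟨s, e⟩ := hG.chain_eq hD hδ (x := fun i => x (i % n)) (k := fun i => k (i % n))
    (fun i => by rw [hstep k hkn]; exact hk _ (hlt i))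
    (fun i => by rw [hstep k hkn, hstep x hx]; exact hseg _ (hlt i)) hQs n m (by simp)
    (fun j _ => by
      rw [Nat.mod_eq_of_lt hm]
      exact hmin _ (Finset.mem_range.2 (hlt _)))
  simp only [hmm, Nat.mod_eq_of_lt hm] at s e
  rw [hG.self (s (left_mem_segment ..)), mul_one, add_comm, hQadd, hQP n le_rfl] at e
  exact mul_eq_right.1 e

end IsCocycle

/-- Two paths in `D` with the same endpoints which stay in a convex subset are homotopic. -/
lemma Path.homotopic_of_convex {D C : Set (ℝ × ℝ)} (hCD : C ⊆ D) (hC : Convex ℝ C) {a b : D}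
    (γ γ' : Path a b) (h : ∀ t, (γ t : ℝ × ℝ) ∈ C) (h' : ∀ t, (γ' t : ℝ × ℝ) ∈ C) :
    γ.Homotopic γ' := by
  have ha : (a : ℝ × ℝ) ∈ C := by simpa using h 0
  have hb : (b : ℝ × ℝ) ∈ C := by simpa using h 1
  have : ContractibleSpace C := hC.contractibleSpace ⟨a, ha⟩
  let ι : C(C, D) := ⟨inclusion hCD, continuous_inclusion hCD⟩
  let lift : ∀ γ : Path a b, (∀ t, (γ t : ℝ × ℝ) ∈ C) → Path (⟨a, ha⟩ : C) ⟨b, hb⟩ :=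
    fun γ h => ⟨⟨fun t => ⟨γ t, h t⟩, by fun_prop⟩, by simp, by simp⟩
  exact (SimplyConnectedSpace.paths_homotopic (lift γ h) (lift γ' h')).map ι

/-- The straight path between two points of `D`. -/
def segmentPath {D : Set (ℝ × ℝ)} (a b : D) (h : segment ℝ (a : ℝ × ℝ) b ⊆ D) : Path a b where
  toFun t := ⟨AffineMap.lineMap (a : ℝ × ℝ) b (t : ℝ),
    h (segment_eq_image_lineMap ℝ (a : ℝ × ℝ) b ▸ mem_image_of_mem _ t.2)⟩
  continuous_toFun := by fun_prop
  source' := by simp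
  target' := by simp

lemma segmentPath_mem {D : Set (ℝ × ℝ)} (a b : D) (h : segment ℝ (a : ℝ × ℝ) b ⊆ D)
    (t : unitInterval) : (segmentPath a b h t : ℝ × ℝ) ∈ segment ℝ (a : ℝ × ℝ) b := by
  rw [segment_eq_image_lineMap]
  exact mem_image_of_mem _ t.2

/-- The class in the fundamental group of the loop obtained from a path by joining its endpoints
to the base point. The path is traversed backwards, so that the concatenation of paths
corresponds to the product. -/
def pathClass {X : Type*} [TopologicalSpace X] {x₀ : X} (c : ∀ a, Path x₀ a) {a b : X}
    (γ : Path a b) : FundamentalGroup X x₀ :=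
  FundamentalGroup.fromPath (.mk ((c b).trans (γ.symm.trans (c a).symm)))

section pathClass

variable {X : Type*} [TopologicalSpace X] {x₀ : X} (c : ∀ a, Path x₀ a) {a b d : X}

open Path.Homotopic.Quotient in
lemma pathClass_trans (γ : Path a b) (γ' : Path b d) :
    pathClass c (γ.trans γ') = pathClass c γ * pathClass c γ' := by
  rw [FundamentalGroup.mul_def]
  simp only [pathClass, FundamentalGroup.fromPath, FundamentalGroup.fromArrow, mk_trans, mk_symm,
    Path.trans_symm, trans_assoc]
  rw [← trans_assoc (mk (c b)).symm, symm_trans, refl_trans]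

lemma pathClass_congr {γ γ' : Path a b} (h : γ.Homotopic γ') :
    pathClass c γ = pathClass c γ' := by
  have : Path.Homotopic.Quotient.mk γ = .mk γ' := Path.Homotopic.Quotient.eq.2 h
  simp [pathClass, this]

lemma pathClass_cast {a' b' : X} (γ : Path a b) (ha : a' = a) (hb : b' = b) :
    pathClass c (γ.cast ha hb) = pathClass c γ := by
  subst ha hb; rfl

open Path.Homotopic.Quotient in
lemma homotopic_refl_of_pathClass_eq_one {γ : Path a a} (h : pathClass c γ = 1) :
    γ.Homotopic (Path.refl a) := by
  rw [← Path.Homotopic.Quotient.eq]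
  have h' : mk ((c a).trans (γ.symm.trans (c a).symm)) = refl x₀ := h
  rw [mk_trans, mk_trans, mk_symm, mk_symm] at h'
  have h2 : (mk γ).symm = refl a := by
    calc (mk γ).symm = (mk (c a)).symm.trans
          (((mk (c a)).trans ((mk γ).symm.trans (mk (c a)).symm)).trans (mk (c a))) := by
          simp only [trans_assoc, symm_trans, trans_refl]
          rw [← trans_assoc, symm_trans, refl_trans]
      _ = refl a := by rw [h', refl_trans, symm_trans]
  calc mk γ = (mk γ).trans (mk γ).symm := by rw [h2, trans_refl]
    _ = mk (Path.refl a) := by rw [trans_symm, mk_refl]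

end pathClass

open Classical in
/-- The cocycle given by the classes of straight paths, for a choice of paths joining all points
to the base point. -/
def segmentCocycle {D : Set (ℝ × ℝ)} {x₀ : D} (c : ∀ a, Path x₀ a) (p q : ℝ × ℝ) :
    FundamentalGroup D x₀ :=
  if h : segment ℝ p q ⊆ D then
    pathClass c (segmentPath ⟨p, h (left_mem_segment ℝ p q)⟩ ⟨q, h (right_mem_segment ℝ p q)⟩ h)
  else 1

section segmentCocycle

variable {D : Set (ℝ × ℝ)} {x₀ : D} (c : ∀ a, Path x₀ a)

/-- The class of a path in a convex subset of `D` is given by its endpoints. -/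
lemma pathClass_eq_segmentCocycle {C : Set (ℝ × ℝ)} (hCD : C ⊆ D) (hC : Convex ℝ C) {a b : D}
    (γ : Path a b) (hγ : ∀ t, (γ t : ℝ × ℝ) ∈ C) : pathClass c γ = segmentCocycle c a b := by
  have hsub : segment ℝ (a : ℝ × ℝ) b ⊆ C :=
    hC.segment_subset (by simpa using hγ 0) (by simpa using hγ 1)
  rw [segmentCocycle, dif_pos (hsub.trans hCD)]
  exact pathClass_congr c (Path.homotopic_of_convex hCD hC _ _ hγ
    fun t => hsub (segmentPath_mem _ _ _ t))

lemma isCocycle_segmentCocycle : IsCocycle D (segmentCocycle c) := by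
  intro C hCD hC p hp q hq r hr
  have hpq := hC.segment_subset hp hq
  have hqr := hC.segment_subset hq hr
  have e := pathClass_eq_segmentCocycle c hCD hC
    ((segmentPath (⟨p, hCD hp⟩ : D) ⟨q, hCD hq⟩ (hpq.trans hCD)).trans
      (segmentPath ⟨q, hCD hq⟩ ⟨r, hCD hr⟩ (hqr.trans hCD))) (fun t => by
      rw [Path.trans_apply]
      split_ifs
      · exact hpq (segmentPath_mem (⟨p, hCD hp⟩ : D) ⟨q, hCD hq⟩ (hpq.trans hCD) _)
      · exact hqr (segmentPath_mem (⟨q, hCD hq⟩ : D) ⟨r, hCD hr⟩ (hqr.trans hCD) _))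
  rw [pathClass_trans] at e
  rw [← e]
  congr 1
  · rw [segmentCocycle, dif_pos]
  · rw [segmentCocycle, dif_pos]

end segmentCocycle

/-- Every loop in a connected domain with the filling property is null-homotopic. -/
lemma HasFilling.homotopic_refl {D : Set (ℝ × ℝ)} (hD : HasFilling D) [PathConnectedSpace D]
    {x₀ : D} (γ : Path x₀ x₀) : γ.Homotopic (Path.refl x₀) := by
  have c : ∀ a, Path x₀ a := fun a => PathConnectedSpace.somePath x₀ a
  have hG := isCocycle_segmentCocycle c
  set G := segmentCocycle c with hGdef
  have hγc : Continuous fun t => (γ t : ℝ × ℝ) := by fun_prop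
  obtain ⟨ε, hε, hth⟩ := (isCompact_range hγc).exists_thickening_subset_open hD.isOpen
    (by rintro _ ⟨t, rfl⟩; exact (γ t).2)
  have hball : ∀ t, ball (γ t : ℝ × ℝ) ε ⊆ D := fun t =>
    (ball_subset_thickening (mem_range_self (f := fun t => (γ t : ℝ × ℝ)) t) ε).trans hth
  set δ := ε / 4 with hδ
  have hδ0 : 0 < δ := by positivity
  obtain ⟨η, hη, hunif⟩ := Metric.uniformContinuous_iff.1
    (CompactSpace.uniformContinuous_of_continuous hγc) δ hδ0
  obtain ⟨n, hn⟩ := exists_nat_one_div_lt hη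
  have hN : (0 : ℝ) < (n : ℝ) + 1 := by positivity
  set t : ℕ → unitInterval := fun i => projIcc 0 1 zero_le_one (i / ((n : ℝ) + 1)) with ht
  have htdist : ∀ i, dist (t (i + 1)) (t i) < η := by
    intro i
    rw [Subtype.dist_eq, Real.dist_eq]
    refine (abs_projIcc_sub_projIcc zero_le_one).trans_lt ?_
    have : ((i + 1 : ℕ) : ℝ) / ((n : ℝ) + 1) - i / ((n : ℝ) + 1) = 1 / ((n : ℝ) + 1) := by
      push_cast; ring
    rw [this, abs_of_pos (by positivity)]
    exact hn
  have hsub : ∀ i s, s ∈ uIcc (t i) (t (i + 1)) → dist (γ s : ℝ × ℝ) (γ (t i)) < δ := by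
    intro i s hs
    refine hunif (lt_of_le_of_lt ?_ (htdist i))
    rw [Subtype.dist_eq, Subtype.dist_eq, Real.dist_eq, Real.dist_eq]
    exact abs_sub_left_of_mem_uIcc hs
  set x : ℕ → ℝ := fun i => (γ (t i) : ℝ × ℝ).1 with hx
  set k : ℕ → ℤ := fun i => ⌊(γ (t i) : ℝ × ℝ).2 / δ⌋ with hk
  have hw : ∀ i, dist (x i, δ * (k i : ℝ)) (γ (t i) : ℝ × ℝ) ≤ δ := by
    intro i
    have h1 := mul_le_mul_of_nonneg_left (Int.floor_le ((γ (t i) : ℝ × ℝ).2 / δ)) hδ0.le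
    have h2 := mul_lt_mul_of_pos_left (Int.lt_floor_add_one ((γ (t i) : ℝ × ℝ).2 / δ)) hδ0
    rw [mul_div_cancel₀ _ hδ0.ne'] at h1 h2
    rw [Prod.dist_eq, max_le_iff, Real.dist_eq, Real.dist_eq]
    constructor
    · simpa [hx] using hδ0.le
    · simp only [hk]
      rw [abs_le]
      constructor <;> linarith
  have hstep : ∀ i, dist (γ (t (i + 1)) : ℝ × ℝ) (γ (t i)) < δ := fun i =>
    hsub i _ right_mem_uIcc
  have hw0 : ∀ i, (x i, δ * (k i : ℝ)) ∈ ball (γ (t i) : ℝ × ℝ) ε := fun i => by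
    rw [mem_ball]; linarith [hw i]
  have hw1 : ∀ i, (x (i + 1), δ * (k (i + 1) : ℝ)) ∈ ball (γ (t i) : ℝ × ℝ) ε := fun i => by
    rw [mem_ball]
    linarith [hw (i + 1), hstep i, dist_triangle (x (i + 1), δ * (k (i + 1) : ℝ))
      (γ (t (i + 1)) : ℝ × ℝ) (γ (t i))]
  have hz0 : ∀ i, (γ (t i) : ℝ × ℝ) ∈ ball (γ (t i) : ℝ × ℝ) ε := fun i => mem_ball_self hε
  have hz1 : ∀ i, (γ (t (i + 1)) : ℝ × ℝ) ∈ ball (γ (t i) : ℝ × ℝ) ε := fun i => by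
    rw [mem_ball]; linarith [hstep i]
  have hkstep : ∀ i, |k (i + 1) - k i| ≤ 1 := by
    intro i
    have h1 : |(γ (t (i + 1)) : ℝ × ℝ).2 - (γ (t i) : ℝ × ℝ).2| < δ := by
      have := hstep i
      rw [Prod.dist_eq, max_lt_iff, Real.dist_eq, Real.dist_eq] at this
      exact this.2
    have h2 : |(γ (t (i + 1)) : ℝ × ℝ).2 / δ - (γ (t i) : ℝ × ℝ).2 / δ| < 1 := by
      rw [← sub_div, abs_div, abs_of_pos hδ0, div_lt_one hδ0]
      exact h1
    rw [abs_lt] at h2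
    simp only [hk]
    rw [abs_le, neg_le_sub_iff_le_add, tsub_le_iff_left]
    have hfloor : ∀ r s : ℝ, r - s < 1 → ⌊r⌋ ≤ ⌊s⌋ + 1 := fun r s h => by
      rw [← Int.floor_add_one]
      exact Int.floor_mono (by linarith)
    exact ⟨hfloor _ _ (by linarith), (hfloor _ _ h2.2).trans_eq (by ring)⟩
  have hseg : ∀ i, segment ℝ (x i, δ * (k i : ℝ)) (x (i + 1), δ * (k (i + 1) : ℝ)) ⊆ D :=
    fun i => ((convex_ball _ _).segment_subset (hw0 i) (hw1 i)).trans (hball _)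
  set P : ℕ → FundamentalGroup D x₀ := fun i => Nat.rec 1
    (fun i g => g * G (x i, δ * (k i : ℝ)) (x (i + 1), δ * (k (i + 1) : ℝ))) i with hP
  have hPs : ∀ i, P (i + 1) = P i * G (x i, δ * (k i : ℝ)) (x (i + 1), δ * (k (i + 1) : ℝ)) :=
    fun i => rfl
  have hmain : ∀ i, pathClass c (γ.subpath (t 0) (t i)) * G (γ (t i)) (x i, δ * (k i : ℝ))
      = G (γ (t 0)) (x 0, δ * (k 0 : ℝ)) * P i := by
    intro i
    induction i with
    | zero =>
      rw [pathClass_eq_segmentCocycle c (hball (t 0)) (convex_ball _ _) _ (fun s => by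
        rw [Path.subpath_self]; exact hz0 0), ← hGdef, hG.self (γ (t 0)).2, one_mul]
      exact (mul_one _).symm
    | succ i ih =>
      have e := pathClass_eq_segmentCocycle c (hball (t i)) (convex_ball _ _)
        (γ.subpath (t i) (t (i + 1))) (fun s => by
          have hs : γ.subpath (t i) (t (i + 1)) s ∈ range (γ.subpath (t i) (t (i + 1))) := ⟨s, rfl⟩
          rw [Path.range_subpath] at hs
          obtain ⟨r, hr, hrs⟩ := hs
          rw [← hrs, mem_ball]
          linarith [hsub i r hr])
      rw [← pathClass_congr c ⟨Path.Homotopy.subpathTransSubpath γ (t 0) (t i) (t (i + 1))⟩,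
        pathClass_trans, e, ← hGdef, mul_assoc,
        hG _ (hball (t i)) (convex_ball _ _) _ (hz0 i) _ (hz1 i) _ (hw1 i), hPs, ← mul_assoc, ← ih,
        mul_assoc, hG _ (hball (t i)) (convex_ball _ _) _ (hz0 i) _ (hw0 i) _ (hw1 i)]
  have ht0 : t 0 = 0 := by simp [ht]
  have ht1 : t (n + 1) = 1 := by
    simp only [ht]
    push_cast
    rw [div_self hN.ne', projIcc_right]; rfl
  have hx1 : x (n + 1) = x 0 := by simp [hx, ht0, ht1]
  have hk1 : k (n + 1) = k 0 := by simp [hk, ht0, ht1]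
  have hP1 : P (n + 1) = 1 := hG.closed_chain_eq_one hD hδ0 n.succ_pos hx1 hk1
    (fun i _ => hkstep i) (fun i _ => hseg i) rfl fun i _ => hPs i
  have hend := hmain (n + 1)
  rw [hP1, mul_one, hx1, hk1, ht1, ht0, Path.subpath_zero_one, pathClass_cast, γ.source,
    γ.target] at hend
  exact homotopic_refl_of_pathClass_eq_one c (mul_eq_right.1 hend)

/-- A connected domain with the filling property is simply connected. -/
theorem HasFilling.isSimplyConnected {D : Set (ℝ × ℝ)} (hD : HasFilling D) (hc : IsConnected D) :
    IsSimplyConnected D := by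
  have : PathConnectedSpace D :=
    isPathConnected_iff_pathConnectedSpace.1 (hD.isOpen.isConnected_iff_isPathConnected.1 hc)
  exact simply_connected_iff_loops_nullhomotopic.2 ⟨this, fun _ γ => hD.homotopic_refl γ⟩

/-- The rotation of the plane sending `(0, 1)` to the unit vector `(e, f)`. -/
def planeRotation (e f : ℝ) (h : e ^ 2 + f ^ 2 = 1) : ℝ × ℝ ≃ₜ ℝ × ℝ where
  toFun p := (p.1 * f + p.2 * e, -p.1 * e + p.2 * f)
  invFun p := (p.1 * f - p.2 * e, p.1 * e + p.2 * f)
  left_inv p := by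
    ext
    · linear_combination p.1 * h
    · linear_combination p.2 * h
  right_inv p := by
    ext
    · linear_combination p.1 * h
    · linear_combination p.2 * h
  continuous_toFun := by fun_prop
  continuous_invFun := by fun_prop

lemma planeRotation_apply {e f : ℝ} (h : e ^ 2 + f ^ 2 = 1) (p : ℝ × ℝ) :
    planeRotation e f h p = (p.1 * f + p.2 * e, -p.1 * e + p.2 * f) := rfl

lemma sqDist_planeRotation {e f : ℝ} (h : e ^ 2 + f ^ 2 = 1) (p q : ℝ × ℝ) :
    sqDist (planeRotation e f h p) (planeRotation e f h q) = sqDist p q := by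
  simp only [sqDist, planeRotation_apply]
  linear_combination ((p.1 - q.1) ^ 2 + (p.2 - q.2) ^ 2) * h

lemma exists_polar (α β : ℝ) :
    ∃ ρ e f : ℝ, 0 ≤ ρ ∧ e ^ 2 + f ^ 2 = 1 ∧ α = ρ * e ∧ β = ρ * f := by
  refine ⟨‖(⟨α, β⟩ : ℂ)‖, Real.cos (Complex.arg ⟨α, β⟩), Real.sin (Complex.arg ⟨α, β⟩),
    norm_nonneg _, Real.cos_sq_add_sin_sq _, ?_, ?_⟩
  · rw [Complex.norm_mul_cos_arg]
  · rw [Complex.norm_mul_sin_arg]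

namespace IsProperTranslator

variable {α β c : ℝ} {Ω : Set (ℝ × ℝ)} {u : ℝ × ℝ → ℝ}

/-- After a rotation, the domain of a proper translator has the filling property. -/
lemma hasFilling_preimage_planeRotation (h : IsProperTranslator α β c Ω u) {ρ e f : ℝ}
    (hρ : 0 ≤ ρ) (hef : e ^ 2 + f ^ 2 = 1) (hα : α = ρ * e) (hβ : β = ρ * f) :
    HasFilling (planeRotation e f hef ⁻¹' Ω) where
  isOpen := h.isOpen.preimage (planeRotation e f hef).continuous
  fill U hU hUb q R hq hfr x hx hR := by
    set T := planeRotation e f hef with hT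
    have hb : Bornology.IsBounded (T '' U) :=
      (hUb.isCompact_closure.image T.continuous).isBounded.subset (image_mono subset_closure)
    refine h.mem_of_frontier (T.isOpenMap _ hU) hb (q := T q) (R := R) ?_ ?_ (T x)
      (mem_image_of_mem T hx) (by rwa [hT, sqDist_planeRotation])
    · rintro _ ⟨y, hy, rfl⟩
      have : ((T y).1 - (T q).1) * α + ((T y).2 - (T q).2) * β = ρ * (y.2 - q.2) := by
        simp only [hT, planeRotation_apply]
        rw [hα, hβ]
        linear_combination ρ * (y.2 - q.2) * hef
      rw [this]
      exact mul_nonneg hρ (sub_nonneg.2 (hq y hy))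
    · rw [← T.image_frontier]
      rintro _ ⟨y, hy, rfl⟩ hRy
      rw [hT, sqDist_planeRotation] at hRy
      exact hfr y hy hRy

/-- The domain of a connected proper translator is simply connected. -/
theorem isSimplyConnected (h : IsProperTranslator α β c Ω u) (hΩ : IsConnected Ω) :
    IsSimplyConnected Ω := by
  obtain ⟨ρ, e, f, hρ, hef, hα, hβ⟩ := exists_polar α β
  rw [← (planeRotation e f hef).isSimplyConnected_preimage]
  exact (h.hasFilling_preimage_planeRotation hρ hef hα hβ).isSimplyConnected
    ((planeRotation e f hef).isConnected_preimage.2 hΩ)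

end IsProperTranslator

namespace IsTranslatingGraph

variable {a b v : E3} {Ω : Set (ℝ × ℝ)} {u : ℝ × ℝ → ℝ} {S : Set E3}

lemma smul_add_smul_add_smul_mem_iff (h : IsTranslatingGraph a b v Ω u S) (p : ℝ × ℝ) (z : ℝ) :
    p.1 • a + p.2 • b + z • v ∈ S ↔ p ∈ Ω ∧ z = u p := by
  rw [h.graph_eq]
  constructor
  · rintro ⟨q, hq, e⟩
    have ha := congrArg (fun w => ⟪a, w⟫) e
    have hb := congrArg (fun w => ⟪b, w⟫) e
    have hv := congrArg (fun w => ⟪v, w⟫) e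
    simp only [inner_add_right, inner_smul_right, real_inner_self_eq_norm_sq, h.norm_a, h.norm_b,
      h.norm_v, h.inner_ab, h.inner_av, h.inner_bv, real_inner_comm a b, real_inner_comm a v,
      real_inner_comm b v] at ha hb hv
    have : p = q := Prod.ext (by linarith) (by linarith)
    subst this
    exact ⟨hq, by linarith⟩
  · rintro ⟨hp, rfl⟩
    exact ⟨p, hp, rfl⟩

/-- A complete translating graph is proper over its domain. -/
lemma isProperTranslator (h : IsTranslatingGraph a b v Ω u S) (hS : IsClosed S) :
    IsProperTranslator ⟪e3, a⟫ ⟪e3, b⟫ ⟪e3, v⟫ Ω u where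
  isOpen := h.isOpen_dom
  abs_c_le := by
    simpa [h.norm_v, e3] using abs_real_inner_le_norm e3 v
  smooth := h.smooth
  pde := h.pde
  proper M := by
    have hcl : IsClosed {x : (ℝ × ℝ) × Icc (-M) M |
        x.1.1 • a + x.1.2 • b + (x.2 : ℝ) • v ∈ S} := hS.preimage (by fun_prop)
    convert isClosedMap_fst_of_compactSpace _ hcl using 1
    ext p
    constructor
    · rintro ⟨hp, hM⟩
      exact ⟨(p, ⟨u p, abs_le.1 hM⟩), (h.smul_add_smul_add_smul_mem_iff p _).2 ⟨hp, rfl⟩, rfl⟩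
    · rintro ⟨⟨_, z⟩, hz, rfl⟩
      obtain ⟨hp, e⟩ := (h.smul_add_smul_add_smul_mem_iff _ _).1 hz
      exact ⟨hp, e ▸ abs_le.2 z.2⟩

end IsTranslatingGraph

/-- the domain of a complete connected translating graph is unbounded and
simply connected. -/
theorem stmt4 (a b v : E3) (Ω : Set (ℝ × ℝ)) (u : ℝ × ℝ → ℝ) (S : Set E3)
    (hgraph : IsTranslatingGraph a b v Ω u S) (hcomplete : IsClosed S) :
    ¬ Bornology.IsBounded Ω ∧ SimplyConnectedSpace Ω := by
  have h := hgraph.isProperTranslator hcomplete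
  exact ⟨h.not_isBounded hgraph.isConnected_dom, h.isSimplyConnected hgraph.isConnected_dom⟩
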